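/- arXiv:2603.16168 — 2 statements merged into one kernel-verified Lean document; each statement's English description precedes it below -/
import Mathlib

section
/- Suppose H : [0,T] × C × ℝⁿ → ℝ satisfies conditions (A.1)–(A.5) and σ : C → ℝ satisfies (A.6), and let φ : [0,T] × C → ℝ be a non-anticipative functional. If φ is lower semicontinuous and possesses property (U), then for any (t,x(·)) ∈ [0,T) × C and s ∈ ℝⁿ there exists a single y(·) ∈ Y(t,x(·);c_H(·)) such that φ(τ,y(·)) − ∫ₜ^τ (⟨s,ẏ(ξ)⟩ − H(ξ,y(·),s)) dξ ≤ φ(t,x(·)) for ALL τ ∈ (t,T]. Analogously, if φ is upper semicontinuous and possesses property (L), then for any (t,x(·)) ∈ [0,T) × C and s ∈ ℝⁿ there exists a single y(·) ∈ Y(t,x(·);c_H(·)) such that φ(τ,y(·)) − ∫ₜ^τ (⟨s,ẏ(ξ)⟩ − H(ξ,y(·),s)) dξ ≥ φ(t,x(·)) for ALL τ ∈ (t,T]. -/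
open MeasureTheory Set Filter Topology

noncomputable section

attribute [local instance] Classical.propDecidable

/-- Euclidean space `ℝⁿ`. -/
abbrev Euc (n : ℕ) : Type := EuclideanSpace ℝ (Fin n)

/-- The path space `C([-h,T], ℝⁿ)` with the sup norm. -/
abbrev PathSp (n : ℕ) (h T : ℝ) : Type := ContinuousMap (Set.Icc (-h) T) (Euc n)

/-- The time map `τ ↦ τ ∧ t` on `[-h,T]` (for `t ∈ [0,T]`, `h ≥ 0`, this is `min τ t`). -/
def stopTime (h T t : ℝ) (τ : Set.Icc (-h) T) : Set.Icc (-h) T :=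
  ⟨max (-h) (min τ.1 t), le_max_left _ _,
    max_le (le_trans τ.2.1 τ.2.2) (le_trans (min_le_left _ _) τ.2.2)⟩

lemma continuous_stopTime (h T t : ℝ) : Continuous (stopTime h T t) :=
  Continuous.subtype_mk
    (continuous_const.max (continuous_subtype_val.min continuous_const)) _

/-- The stopped path `x(· ∧ t)`. -/
def stopPath {n : ℕ} {h T : ℝ} (t : ℝ) (x : PathSp n h T) : PathSp n h T :=
  x.comp ⟨stopTime h T t, continuous_stopTime h T t⟩

/-- Evaluation of a path at a real time (times outside `[-h,T]` are projected). -/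
def evalP {n : ℕ} {h T : ℝ} (x : PathSp n h T) (τ : ℝ) : Euc n :=
  if hc : -h ≤ T then x (Set.projIcc (-h) T hc τ) else 0

/-- The `L¹([0,T])` distance between two functions. -/
def L1dist (T : ℝ) (c₁ c₂ : ℝ → ℝ) : ℝ := ∫ τ in Set.Icc (0:ℝ) T, |c₁ τ - c₂ τ|

/-- A nonnegative function in `L¹([0,T],ℝ)`. -/
def IntegNonneg (T : ℝ) (c : ℝ → ℝ) : Prop :=
  IntegrableOn c (Set.Icc 0 T) volume ∧ ∀ τ ∈ Set.Icc (0:ℝ) T, 0 ≤ c τ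

/-- `AC(t,x(·))`, presented with an explicit derivative witness: pairs `(y, y')`
such that `y(·∧t) = x(·∧t)`, `y'` is integrable on `[t,T]`, and `y` is the
indefinite integral of `y'` on `[t,T]` (i.e. `y|_{[t,T]}` is absolutely continuous
with a.e. derivative `y'`). -/
def ACPair {n : ℕ} {h T : ℝ} (t : ℝ) (x : PathSp n h T) :
    Set (PathSp n h T × (ℝ → Euc n)) :=
  {p | stopPath t p.1 = stopPath t x ∧ IntervalIntegrable p.2 volume t T ∧
       ∀ τ ∈ Set.Icc t T, evalP p.1 τ = evalP p.1 t + ∫ ξ in t..τ, p.2 ξ}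

/-- The set `AC(t,x(·))`. -/
def ACSet {n : ℕ} {h T : ℝ} (t : ℝ) (x : PathSp n h T) : Set (PathSp n h T) :=
  {y | ∃ y', (y, y') ∈ ACPair t x}

/-- Pairs `(y, y')` with `y ∈ Y(t,x(·);c(·))` and derivative witness `y'`. -/
def YPair {n : ℕ} {h T : ℝ} (t : ℝ) (x : PathSp n h T) (c : ℝ → ℝ) :
    Set (PathSp n h T × (ℝ → Euc n)) :=
  {p | p ∈ ACPair t x ∧
       ∀ᵐ τ ∂(volume.restrict (Set.Icc t T)), ‖p.2 τ‖ ≤ c τ * (1 + ‖stopPath τ p.1‖)}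

/-- The set `Y(t,x(·);c(·))`. -/
def YSet {n : ℕ} {h T : ℝ} (t : ℝ) (x : PathSp n h T) (c : ℝ → ℝ) :
    Set (PathSp n h T) :=
  {y | ∃ y', (y, y') ∈ YPair t x c}

/-- Condition (A.1): measurability in `t` on `[0,T]`. -/
def CondA1 {n : ℕ} {h T : ℝ} (H : ℝ → PathSp n h T → Euc n → ℝ) : Prop :=
  ∀ (x : PathSp n h T) (s : Euc n),
    Measurable ((Set.Icc (0:ℝ) T).restrict (fun t => H t x s))

/-- Condition (A.2): continuity in `(x,s)` for a.e. `t`. -/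
def CondA2 {n : ℕ} {h T : ℝ} (H : ℝ → PathSp n h T → Euc n → ℝ) : Prop :=
  ∃ E : Set ℝ, E ⊆ Set.Icc 0 T ∧ volume E = ENNReal.ofReal T ∧
    ∀ t ∈ E, Continuous (fun p : PathSp n h T × Euc n => H t p.1 p.2)

/-- Condition (A.3) for a given compact set `D` and function `λ_H(·;D)`. -/
def CondA3For {n : ℕ} {h T : ℝ} (H : ℝ → PathSp n h T → Euc n → ℝ)
    (D : Set (PathSp n h T)) (lam : ℝ → ℝ) : Prop :=
  IntegNonneg T lam ∧
  ∀ x₁ ∈ D, ∀ x₂ ∈ D, ∀ s : Euc n,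
    ∃ E : Set ℝ, E ⊆ Set.Icc 0 T ∧ volume E = ENNReal.ofReal T ∧
      ∀ t ∈ E, |H t x₁ s - H t x₂ s| ≤
        lam t * (1 + ‖s‖) * ‖stopPath t x₁ - stopPath t x₂‖

/-- Condition (A.3). -/
def CondA3 {n : ℕ} {h T : ℝ} (H : ℝ → PathSp n h T → Euc n → ℝ) : Prop :=
  ∀ D : Set (PathSp n h T), IsCompact D → ∃ lam : ℝ → ℝ, CondA3For H D lam

/-- Condition (A.4), with the function `c_H(·)` made explicit. -/
def CondA4 {n : ℕ} {h T : ℝ} (H : ℝ → PathSp n h T → Euc n → ℝ) (cH : ℝ → ℝ) : Prop :=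
  IntegNonneg T cH ∧
  ∃ E : Set ℝ, E ⊆ Set.Icc 0 T ∧ volume E = ENNReal.ofReal T ∧
    ∀ t ∈ E, ∀ (x : PathSp n h T) (s₁ s₂ : Euc n),
      |H t x s₁ - H t x s₂| ≤ cH t * (1 + ‖stopPath t x‖) * ‖s₁ - s₂‖

/-- Condition (A.5) for a given compact set `D` and function `m_H(·;D)`. -/
def CondA5For {n : ℕ} {h T : ℝ} (H : ℝ → PathSp n h T → Euc n → ℝ)
    (D : Set (PathSp n h T)) (m : ℝ → ℝ) : Prop :=
  IntegNonneg T m ∧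
  ∀ x ∈ D, ∃ E : Set ℝ, E ⊆ Set.Icc 0 T ∧ volume E = ENNReal.ofReal T ∧
    ∀ t ∈ E, |H t x (0 : Euc n)| ≤ m t

/-- Condition (A.5). -/
def CondA5 {n : ℕ} {h T : ℝ} (H : ℝ → PathSp n h T → Euc n → ℝ) : Prop :=
  ∀ D : Set (PathSp n h T), IsCompact D → ∃ m : ℝ → ℝ, CondA5For H D m

/-- Conditions (A.1)–(A.5), with the function `c_H(·)` from (A.4) made explicit. -/
def CondA {n : ℕ} {h T : ℝ} (H : ℝ → PathSp n h T → Euc n → ℝ) (cH : ℝ → ℝ) : Prop :=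
  CondA1 H ∧ CondA2 H ∧ CondA3 H ∧ CondA4 H cH ∧ CondA5 H

/-- A functional `φ` on `[0,T] × C` is non-anticipative. -/
def NonAnticipative {n : ℕ} {h T : ℝ} (φ : ℝ → PathSp n h T → ℝ) : Prop :=
  ∀ t ∈ Set.Icc (0:ℝ) T, ∀ x : PathSp n h T, φ t x = φ t (stopPath t x)

/-- Property (U) from the definition of an upper solution. -/
def PropU {n : ℕ} {h T : ℝ} (H : ℝ → PathSp n h T → Euc n → ℝ) (cH : ℝ → ℝ)
    (φ : ℝ → PathSp n h T → ℝ) : Prop :=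
  ∀ t ∈ Set.Ico (0:ℝ) T, ∀ x : PathSp n h T, ∀ s : Euc n, ∀ τ ∈ Set.Ioc t T,
    ∃ p ∈ YPair t x cH,
      φ τ p.1 - ∫ ξ in t..τ, (@inner ℝ _ _ s (p.2 ξ) - H ξ p.1 s) ≤ φ t x

/-- Property (L) from the definition of a lower solution. -/
def PropL {n : ℕ} {h T : ℝ} (H : ℝ → PathSp n h T → Euc n → ℝ) (cH : ℝ → ℝ)
    (φ : ℝ → PathSp n h T → ℝ) : Prop :=
  ∀ t ∈ Set.Ico (0:ℝ) T, ∀ x : PathSp n h T, ∀ s : Euc n, ∀ τ ∈ Set.Ioc t T,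
    ∃ p ∈ YPair t x cH,
      φ t x ≤ φ τ p.1 - ∫ ξ in t..τ, (@inner ℝ _ _ s (p.2 ξ) - H ξ p.1 s)

/-- Upper solution of the Cauchy problem for `H` (with `c_H` from (A.4)) and `σ`. -/
def UpperSol {n : ℕ} {h T : ℝ} (H : ℝ → PathSp n h T → Euc n → ℝ) (cH : ℝ → ℝ)
    (σ : PathSp n h T → ℝ) (φ : ℝ → PathSp n h T → ℝ) : Prop :=
  NonAnticipative φ ∧
  LowerSemicontinuousOn (fun p : ℝ × PathSp n h T => φ p.1 p.2)
    (Set.Icc 0 T ×ˢ (Set.univ : Set (PathSp n h T))) ∧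
  (∀ x : PathSp n h T, σ x ≤ φ T x) ∧
  PropU H cH φ

/-- Lower solution of the Cauchy problem for `H` (with `c_H` from (A.4)) and `σ`. -/
def LowerSol {n : ℕ} {h T : ℝ} (H : ℝ → PathSp n h T → Euc n → ℝ) (cH : ℝ → ℝ)
    (σ : PathSp n h T → ℝ) (φ : ℝ → PathSp n h T → ℝ) : Prop :=
  NonAnticipative φ ∧
  UpperSemicontinuousOn (fun p : ℝ × PathSp n h T => φ p.1 p.2)
    (Set.Icc 0 T ×ˢ (Set.univ : Set (PathSp n h T))) ∧
  (∀ x : PathSp n h T, φ T x ≤ σ x) ∧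
  PropL H cH φ

/-- Minimax solution of the Cauchy problem. -/
def MinimaxSol {n : ℕ} {h T : ℝ} (H : ℝ → PathSp n h T → Euc n → ℝ) (cH : ℝ → ℝ)
    (σ : PathSp n h T → ℝ) (φ : ℝ → PathSp n h T → ℝ) : Prop :=
  UpperSol H cH σ φ ∧ LowerSol H cH σ φ

/-- `φ` is ci-differentiable at `(t,x(·))` with ci-derivatives `a = ∂ₜφ(t,x(·))`
and `g = ∇φ(t,x(·))`. -/
def HasCiDeriv {n : ℕ} {h T : ℝ} (φ : ℝ → PathSp n h T → ℝ)
    (t : ℝ) (x : PathSp n h T) (a : ℝ) (g : Euc n) : Prop :=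
  ∀ p ∈ ACPair t x, ∃ o : ℝ → ℝ,
    (∀ τ ∈ Set.Ioc t T,
      φ τ p.1 - φ t x =
        a * (τ - t) + @inner ℝ _ _ g (evalP p.1 τ - evalP x t) + o (τ - t)) ∧
    Tendsto (fun τ => o (τ - t) / (τ - t + ∫ ξ in t..τ, ‖p.2 ξ‖))
      (nhdsWithin t (Set.Ioi t)) (nhds 0)

/-- `φ ∈ Φ`, with the ci-derivatives `Dt = ∂ₜφ`, `Dx = ∇φ` and the full-measure
set `Eφ` of ci-differentiability made explicit. -/
structure IsInPhi {n : ℕ} {h T : ℝ} (φ : ℝ → PathSp n h T → ℝ)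
    (Dt : ℝ → PathSp n h T → ℝ) (Dx : ℝ → PathSp n h T → Euc n)
    (Eφ : Set ℝ) : Prop where
  cont : ContinuousOn (fun p : ℝ × PathSp n h T => φ p.1 p.2)
    (Set.Icc 0 T ×ˢ (Set.univ : Set (PathSp n h T)))
  absCont : ∀ t ∈ Set.Ico (0:ℝ) T, ∀ x : PathSp n h T, ∀ p ∈ ACPair t x,
    ∀ θ ∈ Set.Ioo t T, ∃ g : ℝ → ℝ, IntervalIntegrable g volume t θ ∧
      ∀ τ ∈ Set.Icc t θ, φ τ p.1 = φ t p.1 + ∫ ξ in t..τ, g ξ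
  Esub : Eφ ⊆ Set.Ico 0 T
  Efull : volume Eφ = ENNReal.ofReal T
  ciDiff : ∀ t ∈ Eφ, ∀ x : PathSp n h T, HasCiDeriv φ t x (Dt t x) (Dx t x)
  measD : ∀ x : PathSp n h T, Measurable (Eφ.restrict (fun t => (Dt t x, Dx t x)))
  contD : ∀ t ∈ Eφ, Continuous (fun x : PathSp n h T => (Dt t x, Dx t x))
  bddD : ∀ D : Set (PathSp n h T), IsCompact D → ∀ θ ∈ Set.Ico (0:ℝ) T,
    ∃ m : ℝ → ℝ, (IntegrableOn m (Set.Icc 0 θ) volume ∧ ∀ τ ∈ Set.Icc (0:ℝ) θ, 0 ≤ m τ) ∧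
      ∃ ℓ : ℝ, 0 < ℓ ∧ ∀ t ∈ Eφ ∩ Set.Icc 0 θ, ∀ x ∈ D, |Dt t x| ≤ m t ∧ ‖Dx t x‖ ≤ ℓ

/-- Semiclassical solution of the Cauchy problem (with derivative data). -/
def SemiclassicalSol {n : ℕ} {h T : ℝ} (H : ℝ → PathSp n h T → Euc n → ℝ)
    (σ : PathSp n h T → ℝ) (φ : ℝ → PathSp n h T → ℝ)
    (Dt : ℝ → PathSp n h T → ℝ) (Dx : ℝ → PathSp n h T → Euc n) (Eφ : Set ℝ) : Prop :=
  IsInPhi φ Dt Dx Eφ ∧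
  (∀ t ∈ Eφ, ∀ x : PathSp n h T, Dt t x + H t x (Dx t x) = 0) ∧
  ∀ x : PathSp n h T, φ T x = σ x

/-- The Steklov transform of `H` with respect to the first (time) variable,
with `H` extended by `0` outside `[0,T]`. -/
def steklov {n : ℕ} {h T : ℝ} (H : ℝ → PathSp n h T → Euc n → ℝ) (k : ℕ)
    (t : ℝ) (x : PathSp n h T) (s : Euc n) : ℝ :=
  ((k : ℝ) / 2) * ∫ τ in (t - (k : ℝ)⁻¹)..(t + (k : ℝ)⁻¹),
    (if τ ∈ Set.Icc (0:ℝ) T then H τ (stopPath t x) s else 0)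

/-! ### Differential game definitions -/

/-- Admissible controls with values in `P`. -/
def Ctrl {m : ℕ} (P : Set (Euc m)) : Set (ℝ → Euc m) :=
  {u | Measurable u ∧ ∀ τ, u τ ∈ P}

/-- Non-anticipative strategies mapping `Q`-valued controls to `P`-valued controls
on the interval `[t,T]`. -/
def NAStrat {mP mQ : ℕ} (P : Set (Euc mP)) (Q : Set (Euc mQ)) (t T : ℝ) :
    Set ((ℝ → Euc mQ) → ℝ → Euc mP) :=
  {α | (∀ v ∈ Ctrl Q, α v ∈ Ctrl P) ∧
    ∀ τ ∈ Set.Icc t T, ∀ v ∈ Ctrl Q, ∀ v' ∈ Ctrl Q,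
      (∀ᵐ ξ ∂(volume.restrict (Set.Icc t τ)), v ξ = v' ξ) →
      (∀ᵐ ξ ∂(volume.restrict (Set.Icc t τ)), α v ξ = α v' ξ)}

/-- `(y, y')` is (the derivative-witnessed) motion of the time-delay system
generated by `f` from `(t,x(·))` under controls `u(·)`, `v(·)`. -/
def IsMotion {n : ℕ} {h T : ℝ} {mP mQ : ℕ}
    (f : ℝ → PathSp n h T → Euc mP → Euc mQ → Euc n)
    (t : ℝ) (x : PathSp n h T) (u : ℝ → Euc mP) (v : ℝ → Euc mQ)
    (p : PathSp n h T × (ℝ → Euc n)) : Prop :=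
  p ∈ ACPair t x ∧
  ∀ᵐ τ ∂(volume.restrict (Set.Icc t T)), p.2 τ = f τ p.1 (u τ) (v τ)

/-- The set of values of the cost functional along motions (a singleton when
the motion exists and is unique). -/
def costVals {n : ℕ} {h T : ℝ} {mP mQ : ℕ}
    (f : ℝ → PathSp n h T → Euc mP → Euc mQ → Euc n)
    (χ : ℝ → PathSp n h T → Euc mP → Euc mQ → ℝ) (σ : PathSp n h T → ℝ)
    (t : ℝ) (x : PathSp n h T) (u : ℝ → Euc mP) (v : ℝ → Euc mQ) : Set ℝ :=
  {r | ∃ p : PathSp n h T × (ℝ → Euc n), IsMotion f t x u v p ∧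
        r = σ p.1 - ∫ τ in t..T, χ τ p.1 (u τ) (v τ)}

/-- The lower value `ρ⁻(t,x(·))` of the differential game. -/
def lowerValue {n : ℕ} {h T : ℝ} {mP mQ : ℕ} (P : Set (Euc mP)) (Q : Set (Euc mQ))
    (f : ℝ → PathSp n h T → Euc mP → Euc mQ → Euc n)
    (χ : ℝ → PathSp n h T → Euc mP → Euc mQ → ℝ) (σ : PathSp n h T → ℝ)
    (t : ℝ) (x : PathSp n h T) : ℝ :=
  sInf ((fun α => sSup (⋃ v ∈ Ctrl Q, costVals f χ σ t x (α v) v)) '' NAStrat P Q t T)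

/-- The upper value `ρ⁺(t,x(·))` of the differential game. -/
def upperValue {n : ℕ} {h T : ℝ} {mP mQ : ℕ} (P : Set (Euc mP)) (Q : Set (Euc mQ))
    (f : ℝ → PathSp n h T → Euc mP → Euc mQ → Euc n)
    (χ : ℝ → PathSp n h T → Euc mP → Euc mQ → ℝ) (σ : PathSp n h T → ℝ)
    (t : ℝ) (x : PathSp n h T) : ℝ :=
  sSup ((fun β => sInf (⋃ u ∈ Ctrl P, costVals f χ σ t x u (β u))) '' NAStrat Q P t T)

/-- The lower Hamiltonian `H⁻` (defined via the full-measure set `EC` from (C.2)). -/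
def Hlow {n : ℕ} {h T : ℝ} {mP mQ : ℕ} (P : Set (Euc mP)) (Q : Set (Euc mQ))
    (f : ℝ → PathSp n h T → Euc mP → Euc mQ → Euc n)
    (χ : ℝ → PathSp n h T → Euc mP → Euc mQ → ℝ) (EC : Set ℝ)
    (τ : ℝ) (y : PathSp n h T) (s : Euc n) : ℝ :=
  if τ ∈ EC then
    sSup ((fun v => sInf ((fun u => @inner ℝ _ _ s (f τ y u v) - χ τ y u v) '' P)) '' Q)
  else 0

/-- The upper Hamiltonian `H⁺` (defined via the full-measure set `EC` from (C.2)). -/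
def Hup {n : ℕ} {h T : ℝ} {mP mQ : ℕ} (P : Set (Euc mP)) (Q : Set (Euc mQ))
    (f : ℝ → PathSp n h T → Euc mP → Euc mQ → Euc n)
    (χ : ℝ → PathSp n h T → Euc mP → Euc mQ → ℝ) (EC : Set ℝ)
    (τ : ℝ) (y : PathSp n h T) (s : Euc n) : ℝ :=
  if τ ∈ EC then
    sInf ((fun u => sSup ((fun v => @inner ℝ _ _ s (f τ y u v) - χ τ y u v) '' Q)) '' P)
  else 0

/-- Assumption (C) on the data `(f, χ, σ)` of the differential game, with the
full-measure set `EC` from (C.2) and the function `c_f(·)` from (C.4) explicit. -/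
structure AssumpC {n : ℕ} {h T : ℝ} {mP mQ : ℕ} (P : Set (Euc mP)) (Q : Set (Euc mQ))
    (f : ℝ → PathSp n h T → Euc mP → Euc mQ → Euc n)
    (χ : ℝ → PathSp n h T → Euc mP → Euc mQ → ℝ)
    (σ : PathSp n h T → ℝ) (EC : Set ℝ) (cf : ℝ → ℝ) : Prop where
  meas : ∀ (y : PathSp n h T) (u : Euc mP) (v : Euc mQ),
    Measurable ((Set.Icc (0:ℝ) T).restrict (fun τ => (f τ y u v, χ τ y u v)))
  ECsub : EC ⊆ Set.Icc 0 T
  ECfull : volume EC = ENNReal.ofReal T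
  contOn : ∀ τ ∈ EC, ContinuousOn
    (fun p : PathSp n h T × Euc mP × Euc mQ => (f τ p.1 p.2.1 p.2.2, χ τ p.1 p.2.1 p.2.2))
    ((Set.univ : Set (PathSp n h T)) ×ˢ P ×ˢ Q)
  lip : ∀ D : Set (PathSp n h T), IsCompact D → ∃ lam : ℝ → ℝ, IntegNonneg T lam ∧
    ∃ E : Set ℝ, E ⊆ Set.Icc 0 T ∧ volume E = ENNReal.ofReal T ∧
      ∀ τ ∈ E, ∀ y₁ ∈ D, ∀ y₂ ∈ D, ∀ u ∈ P, ∀ v ∈ Q,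
        ‖f τ y₁ u v - f τ y₂ u v‖ + |χ τ y₁ u v - χ τ y₂ u v| ≤
          lam τ * ‖stopPath τ y₁ - stopPath τ y₂‖
  growth : IntegNonneg T cf ∧
    ∃ E : Set ℝ, E ⊆ Set.Icc 0 T ∧ volume E = ENNReal.ofReal T ∧
      ∀ τ ∈ E, ∀ y : PathSp n h T, ∀ u ∈ P, ∀ v ∈ Q,
        ‖f τ y u v‖ ≤ cf τ * (1 + ‖stopPath τ y‖)
  bdd : ∀ D : Set (PathSp n h T), IsCompact D → ∃ m : ℝ → ℝ, IntegNonneg T m ∧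
    ∃ E : Set ℝ, E ⊆ Set.Icc 0 T ∧ volume E = ENNReal.ofReal T ∧
      ∀ τ ∈ E, ∀ y ∈ D, ∀ u ∈ P, ∀ v ∈ Q, |χ τ y u v| ≤ m τ
  sigC : Continuous σ


namespace S7

lemma evalP_eq {n : ℕ} {h T : ℝ} (y : PathSp n h T) {τ : ℝ} (hτ : τ ∈ Icc (-h) T) :
    evalP y τ = y ⟨τ, hτ⟩ := by
  unfold evalP
  rw [dif_pos (hτ.1.trans hτ.2), projIcc_of_mem _ hτ]

lemma stop_stop {n : ℕ} {h T : ℝ} (y : PathSp n h T) {a b : ℝ} (hab : a ≤ b) :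
    stopPath a (stopPath b y) = stopPath a y := by
  ext1 r
  have : stopTime h T b (stopTime h T a r) = stopTime h T a r := by
    apply Subtype.ext
    simp only [stopTime]
    grind
  simp [stopPath, this]

lemma norm_stop_le {n : ℕ} {h T : ℝ} (y : PathSp n h T) (a : ℝ) :
    ‖stopPath a y‖ ≤ ‖y‖ := by
  rw [ContinuousMap.norm_le _ (norm_nonneg _)]
  intro r
  exact y.norm_coe_le_norm _

lemma norm_stop_mono {n : ℕ} {h T : ℝ} (y : PathSp n h T) {a b : ℝ} (hab : a ≤ b) :
    ‖stopPath a y‖ ≤ ‖stopPath b y‖ := by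
  rw [← stop_stop y hab]
  exact norm_stop_le _ _

lemma stop_sub {n : ℕ} {h T : ℝ} (y z : PathSp n h T) (a : ℝ) :
    stopPath a y - stopPath a z = stopPath a (y - z) := by
  ext1 r
  simp [stopPath]

lemma stop_T {n : ℕ} {h T : ℝ} (hh : 0 ≤ h) (y : PathSp n h T) :
    stopPath T y = y := by
  ext1 r
  have : stopTime h T T r = r := by
    apply Subtype.ext
    have := r.2.1
    have := r.2.2
    simp only [stopTime]
    grind
  simp [stopPath, this]

lemma evalP_stop {n : ℕ} {h T : ℝ} (y : PathSp n h T) {τ b : ℝ} (hτ : τ ∈ Icc (-h) T)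
    (hb : τ ≤ b) : evalP (stopPath b y) τ = evalP y τ := by
  rw [evalP_eq _ hτ, evalP_eq _ hτ]
  have : stopTime h T b ⟨τ, hτ⟩ = ⟨τ, hτ⟩ := by
    apply Subtype.ext
    have := hτ.1
    simp only [stopTime]
    grind
  simp [stopPath, this]

lemma norm_evalP_le {n : ℕ} {h T : ℝ} (y : PathSp n h T) {τ b : ℝ} (hτ : τ ∈ Icc (-h) T)
    (hb : τ ≤ b) : ‖evalP y τ‖ ≤ ‖stopPath b y‖ := by
  rw [← evalP_stop y hτ hb, evalP_eq _ hτ]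
  exact ContinuousMap.norm_coe_le_norm _ _

lemma evalP_congr {n : ℕ} {h T : ℝ} {y z : PathSp n h T} {τ b : ℝ}
    (hyz : stopPath b y = stopPath b z) (hτ : τ ∈ Icc (-h) T)
    (hb : τ ≤ b) : evalP y τ = evalP z τ := by
  rw [← evalP_stop y hτ hb, hyz, evalP_stop z hτ hb]

lemma stop_congr {n : ℕ} {h T : ℝ} {y z : PathSp n h T} {τ b : ℝ}
    (hyz : stopPath b y = stopPath b z)
    (hb : τ ≤ b) : stopPath τ y = stopPath τ z := by
  rw [← stop_stop y hb, hyz, stop_stop z hb]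

lemma continuous_stop_time {n : ℕ} {h T : ℝ} (y : PathSp n h T) :
    Continuous (fun b => stopPath b y) := by
  let F : C(ℝ × Icc (-h) T, Euc n) := ⟨fun p => y (stopTime h T p.1 p.2), by
    apply y.continuous.comp
    unfold stopTime
    fun_prop⟩
  exact F.curry.continuous

lemma continuous_stop_path {n : ℕ} {h T : ℝ} (a : ℝ) :
    Continuous (fun y : PathSp n h T => stopPath a y) :=
  ContinuousMap.continuous_precomp _

lemma continuous_evalP_path {n : ℕ} {h T : ℝ} {τ : ℝ} :
    Continuous (fun y : PathSp n h T => evalP y τ) := by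
  unfold evalP
  split_ifs
  · exact continuous_eval_const _
  · exact continuous_const

lemma continuous_evalP {n : ℕ} {h T : ℝ} (y : PathSp n h T) :
    Continuous (fun τ : ℝ => evalP y τ) := by
  unfold evalP
  split_ifs
  · exact y.continuous.comp continuous_projIcc
  · exact continuous_const

/-- Integral form of the set `Y(t,x;c)`. -/
def KSet {n : ℕ} {h T : ℝ} (t : ℝ) (x : PathSp n h T) (c : ℝ → ℝ) : Set (PathSp n h T) :=
  {y | stopPath t y = stopPath t x ∧ ∀ a b, t ≤ a → a ≤ b → b ≤ T →
    ‖evalP y b - evalP y a‖ ≤ (∫ ξ in a..b, c ξ) * (1 + ‖stopPath b y‖)}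

lemma c_int {T : ℝ} {c : ℝ → ℝ} (hc : IntegNonneg T c) {a b : ℝ} (ha : 0 ≤ a) (hab : a ≤ b)
    (hb : b ≤ T) : IntervalIntegrable c volume a b := by
  rw [intervalIntegrable_iff_integrableOn_Ioc_of_le hab]
  exact hc.1.mono_set (fun x hx => ⟨ha.trans hx.1.le, hx.2.trans hb⟩)

lemma c_nonneg {T : ℝ} {c : ℝ → ℝ} (hc : IntegNonneg T c) {a b : ℝ} (ha : 0 ≤ a) (hab : a ≤ b)
    (hb : b ≤ T) : 0 ≤ ∫ ξ in a..b, c ξ :=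
  intervalIntegral.integral_nonneg hab (fun u hu => hc.2 u ⟨ha.trans hu.1, hu.2.trans hb⟩)

lemma c_split {T : ℝ} {c : ℝ → ℝ} (hc : IntegNonneg T c) {a m b : ℝ} (ha : 0 ≤ a) (ham : a ≤ m)
    (hmb : m ≤ b) (hb : b ≤ T) :
    ∫ ξ in a..b, c ξ = (∫ ξ in a..m, c ξ) + ∫ ξ in m..b, c ξ :=
  (intervalIntegral.integral_add_adjacent_intervals (c_int hc ha ham (hmb.trans hb))
    (c_int hc (ha.trans ham) hmb hb)).symm

lemma YPair_sub_KSet {n : ℕ} {h T : ℝ} {t : ℝ} (ht : 0 ≤ t) {x : PathSp n h T}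
    {c : ℝ → ℝ} (hc : IntegNonneg T c) {p : PathSp n h T × (ℝ → Euc n)} (hp : p ∈ YPair t x c) :
    p.1 ∈ KSet t x c := by
  obtain ⟨⟨h1, h2, h3⟩, h4⟩ := hp
  refine ⟨h1, fun a b hta hab hbT => ?_⟩
  have hi : ∀ u v, t ≤ u → u ≤ v → v ≤ T → IntervalIntegrable p.2 volume u v := by
    intro u v h5 h6 h7
    apply h2.mono_set
    rw [uIcc_of_le h6, uIcc_of_le (h5.trans (h6.trans h7))]
    exact Icc_subset_Icc h5 h7
  have e : evalP p.1 b - evalP p.1 a = ∫ ξ in a..b, p.2 ξ := by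
    rw [h3 b ⟨hta.trans hab, hbT⟩, h3 a ⟨hta, hab.trans hbT⟩,
      ← intervalIntegral.integral_add_adjacent_intervals (hi t a le_rfl hta (hab.trans hbT))
        (hi a b hta hab hbT)]
    abel
  rw [e, ← intervalIntegral.integral_mul_const]
  refine intervalIntegral.norm_integral_le_of_norm_le hab ?_
    ((c_int hc (ht.trans hta) hab hbT).mul_const _)
  rw [ae_restrict_iff' measurableSet_Icc] at h4
  filter_upwards [h4] with ξ hξ hm
  refine (hξ ⟨hta.trans hm.1.le, hm.2.trans hbT⟩).trans ?_
  have := norm_stop_mono p.1 hm.2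
  have := hc.2 ξ ⟨ht.trans (hta.trans hm.1.le), hm.2.trans hbT⟩
  gcongr

lemma ac_of_KSet {n : ℕ} {h T : ℝ} {t : ℝ} (hh : 0 ≤ h) (ht : 0 ≤ t) (htT : t ≤ T)
    {x : PathSp n h T}
    {c : ℝ → ℝ} (hc : IntegNonneg T c) {y : PathSp n h T} (hy : y ∈ KSet t x c) (i : Fin n) :
    AbsolutelyContinuousOnInterval (fun r => evalP y r i) t T := by
  have hC := (c_int hc ht htT le_rfl).absolutelyContinuousOnInterval_intervalIntegral
    (c := t) left_mem_uIcc
  have key : ∀ a b, t ≤ a → a ≤ b → b ≤ T → dist (evalP y a i) (evalP y b i) ≤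
      (1 + ‖y‖) * dist (∫ ξ in t..a, c ξ) (∫ ξ in t..b, c ξ) := by
    intro a b hta hab hbT
    have h1 := hy.2 a b hta hab hbT
    have h2 := c_split hc ht hta hab hbT
    have h3 := c_nonneg hc (ht.trans hta) hab hbT
    have h4 := norm_stop_le y b
    have h5 : dist (evalP y a i) (evalP y b i) ≤ ‖evalP y b - evalP y a‖ := by
      rw [dist_comm, dist_eq_norm]
      exact PiLp.norm_apply_le (evalP y b - evalP y a) i
    have h6 : dist (∫ ξ in t..a, c ξ) (∫ ξ in t..b, c ξ) = ∫ ξ in a..b, c ξ := by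
      rw [dist_comm, Real.dist_eq, h2, add_sub_cancel_left, abs_of_nonneg h3]
    rw [h6]
    nlinarith
  have h0 := Filter.Tendsto.const_mul (1 + ‖y‖) hC
  rw [mul_zero] at h0
  refine squeeze_zero' (Eventually.of_forall fun E => Finset.sum_nonneg fun i _ => dist_nonneg)
    ?_ h0
  filter_upwards [mem_inf_of_right (mem_principal_self _)] with E hE
  rw [Finset.mul_sum]
  refine Finset.sum_le_sum fun j hj => ?_
  have hE' := hE.1 j hj
  rw [uIcc_of_le htT] at hE'
  rcases le_total (E.2 j).1 (E.2 j).2 with hl | hl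
  · exact key _ _ hE'.1.1 hl hE'.2.2
  · rw [dist_comm, dist_comm (∫ ξ in t..(E.2 j).1, c ξ)]
    exact key _ _ hE'.2.1 hl hE'.1.2

lemma KSet_sub_YSet {n : ℕ} {h T : ℝ} {t : ℝ} (hh : 0 ≤ h) (ht : 0 ≤ t) (htT : t ≤ T)
    {x : PathSp n h T}
    {c : ℝ → ℝ} (hc : IntegNonneg T c) {y : PathSp n h T} (hy : y ∈ KSet t x c) :
    ∃ y', (y, y') ∈ YPair t x c := by
  have hac := ac_of_KSet hh ht htT hc hy
  have hdiff : ∀ᵐ r, r ∈ Icc t T → DifferentiableAt ℝ (fun r => evalP y r) r := by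
    have := ae_all_iff.2 (fun i => (hac i).ae_differentiableAt)
    filter_upwards [this] with r hr hm
    rw [differentiableAt_piLp]
    intro i
    exact hr i (by rwa [uIcc_of_le htT])
  have hcoord : ∀ r, DifferentiableAt ℝ (fun r => evalP y r) r → ∀ i,
      deriv (fun r => evalP y r) r i = deriv (fun r => evalP y r i) r := by
    intro r hr i
    have := (EuclideanSpace.proj (𝕜 := ℝ) i).hasFDerivAt.comp_hasDerivAt r hr.hasDerivAt
    exact this.deriv.symm
  have hIntv : ∀ a b, t ≤ a → a ≤ b → b ≤ T → ∀ i,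
      IntervalIntegrable (fun r => deriv (fun r => evalP y r) r i) volume a b ∧
      ∫ r in a..b, deriv (fun r => evalP y r) r i = evalP y b i - evalP y a i := by
    intro a b hta hab hbT i
    have h1 : AbsolutelyContinuousOnInterval (fun r => evalP y r i) a b :=
      (hac i).mono (by
        rw [uIcc_of_le hab, uIcc_of_le htT]; exact Icc_subset_Icc hta hbT)
    have h2 : ∀ᵐ r, r ∈ uIoc a b → deriv (fun r => evalP y r i) r =
        deriv (fun r => evalP y r) r i := by
      filter_upwards [hdiff] with r hr hm
      rw [uIoc_of_le hab] at hm
      exact (hcoord r (hr ⟨hta.trans hm.1.le, hm.2.trans hbT⟩) i).symm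
    refine ⟨h1.intervalIntegrable_deriv.congr_ae
      ((ae_restrict_iff' measurableSet_uIoc).2 h2), ?_⟩
    rw [← h1.integral_deriv_eq_sub]
    refine (intervalIntegral.integral_congr_ae h2).symm
  refine ⟨deriv (fun r => evalP y r), ⟨hy.1, ?_, ?_⟩, ?_⟩
  · rw [intervalIntegrable_iff_integrableOn_Ioc_of_le htT]
    refine integrable_piLp_iff.2 fun i => ?_
    have := (hIntv t T le_rfl htT le_rfl i).1
    rwa [intervalIntegrable_iff_integrableOn_Ioc_of_le htT] at this
  · intro τ hτ
    dsimp only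
    ext i
    have h1 := hIntv t τ le_rfl hτ.1 hτ.2
    have h2 : (∫ r in t..τ, deriv (fun r => evalP y r) r) i
        = ∫ r in t..τ, deriv (fun r => evalP y r) r i := by
      rw [intervalIntegral.integral_of_le hτ.1, intervalIntegral.integral_of_le hτ.1]
      refine eval_integral_piLp (fun i => ?_) i
      have := (h1 i).1
      rwa [intervalIntegrable_iff_integrableOn_Ioc_of_le hτ.1] at this
    rw [PiLp.add_apply, h2, (h1 i).2]
    ring
  · rw [ae_restrict_iff' measurableSet_Icc]
    have hT : ∀ᵐ r : ℝ, r ≠ T := by simp [ae_iff, measure_singleton]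
    filter_upwards [hdiff, hT, (c_int hc ht htT le_rfl).ae_hasDerivAt_integral] with τ h1 h2 h3 hm
    have hd := (h1 hm).hasDerivAt
    have hC := h3 (by rwa [uIcc_of_le htT]) t left_mem_uIcc
    have hτT : τ < T := lt_of_le_of_ne hm.2 h2
    rw [hasDerivAt_iff_tendsto_slope] at hd hC
    have hsub : 𝓝[>] τ ≤ 𝓝[≠] τ := nhdsWithin_mono _ (fun r hr => (ne_of_gt hr))
    have hd' := (hd.mono_left hsub).norm
    have hg : Tendsto (fun r => 1 + ‖stopPath r y‖) (𝓝[>] τ) (𝓝 (1 + ‖stopPath τ y‖)) :=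
      ((continuous_const.add (continuous_stop_time y).norm).tendsto τ).mono_left
        nhdsWithin_le_nhds
    have hC' := (hC.mono_left hsub).mul hg
    refine le_of_tendsto_of_tendsto hd' hC' ?_
    filter_upwards [Ioo_mem_nhdsGT hτT] with r hr
    have h5 := hy.2 τ r hm.1 hr.1.le hr.2.le
    have h6 := c_split hc ht hm.1 hr.1.le hr.2.le
    have h7 : 0 < r - τ := sub_pos.2 hr.1
    rw [slope_def_module, slope_def_module, norm_smul, h6, add_sub_cancel_left, norm_inv,
      Real.norm_of_nonneg h7.le, smul_eq_mul, mul_assoc]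
    gcongr

lemma isClosed_KSet {n : ℕ} {h T : ℝ} {t : ℝ} (x : PathSp n h T) (c : ℝ → ℝ) :
    IsClosed (KSet t x c) := by
  have : KSet t x c = {y | stopPath t y = stopPath t x} ∩ ⋂ (a : ℝ) (b : ℝ) (_ : t ≤ a)
      (_ : a ≤ b) (_ : b ≤ T), {y : PathSp n h T |
        ‖evalP y b - evalP y a‖ ≤ (∫ ξ in a..b, c ξ) * (1 + ‖stopPath b y‖)} := by
    ext y
    simp [KSet]
  rw [this]
  refine (isClosed_eq (continuous_stop_path t) continuous_const).inter ?_
  refine isClosed_iInter fun a => isClosed_iInter fun b => isClosed_iInter fun _ =>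
    isClosed_iInter fun _ => isClosed_iInter fun _ => ?_
  exact isClosed_le (continuous_evalP_path.sub continuous_evalP_path).norm
    (continuous_const.mul (continuous_const.add (continuous_stop_path b).norm))

lemma norm_step {n : ℕ} {h T : ℝ} {t : ℝ} (hh : 0 ≤ h) (ht : 0 ≤ t)
    {x : PathSp n h T}
    {c : ℝ → ℝ} (hc : IntegNonneg T c) {y : PathSp n h T} (hy : y ∈ KSet t x c)
    {a b : ℝ} (hta : t ≤ a) (hab : a ≤ b) (hbT : b ≤ T) :
    ‖stopPath b y‖ ≤ ‖stopPath a y‖ + (∫ ξ in a..b, c ξ) * (1 + ‖stopPath b y‖) := by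
  have h3 := c_nonneg hc (ht.trans hta) hab hbT
  rw [ContinuousMap.norm_le _ (by positivity)]
  intro r
  have e : stopPath b y r = evalP y (stopTime h T b r) := by
    rw [evalP_eq _ (stopTime h T b r).2]; rfl
  have hub : (stopTime h T b r : ℝ) ≤ b := by
    simp only [stopTime]; grind
  have hu := (stopTime h T b r).2
  rw [e]
  set u : ℝ := (stopTime h T b r).1
  rcases le_total u a with hua | hua
  · have := norm_evalP_le y hu hua
    have : 0 ≤ (∫ ξ in a..b, c ξ) * (1 + ‖stopPath b y‖) := by positivity
    linarith
  · have h1 := hy.2 a u hta hua (hub.trans hbT)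
    have h2 := norm_evalP_le y (τ := a) (b := a) ⟨by linarith, hab.trans hbT⟩ le_rfl
    have h4 : evalP y u = evalP y a + (evalP y u - evalP y a) := by abel
    have h5 := norm_add_le (evalP y a) (evalP y u - evalP y a)
    rw [← h4] at h5
    have h6 := c_split hc (ht.trans hta) hua hub hbT
    have h7 := c_nonneg hc (ht.trans (hta.trans hua)) hub hbT
    have h8 := norm_stop_mono y hub
    have h9 : (∫ ξ in a..u, c ξ) * (1 + ‖stopPath u y‖) ≤
        (∫ ξ in a..b, c ξ) * (1 + ‖stopPath b y‖) := by
      gcongr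
      linarith
    linarith

lemma KSet_bdd {n : ℕ} {h T : ℝ} {t : ℝ} (hh : 0 ≤ h) (ht : 0 ≤ t) (htT : t ≤ T)
    (x : PathSp n h T)
    {c : ℝ → ℝ} (hc : IntegNonneg T c) : ∃ R, ∀ y ∈ KSet t x c, ‖y‖ ≤ R := by
  have hC := (c_int hc ht htT le_rfl).absolutelyContinuousOnInterval_intervalIntegral
    (c := t) left_mem_uIcc
  have hu := hC.uniformContinuousOn
  rw [uIcc_of_le htT, Metric.uniformContinuousOn_iff] at hu
  obtain ⟨δ, hδ, hu⟩ := hu (1/2) (by norm_num)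
  have key : ∀ k : ℕ, ∃ R, ∀ y ∈ KSet t x c, ‖stopPath (min T (t + k * (δ / 2))) y‖ ≤ R := by
    intro k
    induction k with
    | zero =>
      refine ⟨‖stopPath t x‖, fun y hy => ?_⟩
      rw [← hy.1]
      exact norm_stop_mono y (by simp)
    | succ k ih =>
      obtain ⟨R, hR⟩ := ih
      refine ⟨2 * R + 1, fun y hy => ?_⟩
      have hk : (0:ℝ) ≤ k * (δ / 2) := by positivity
      set a := min T (t + k * (δ / 2)) with ha
      set b := min T (t + (k + 1 : ℕ) * (δ / 2)) with hb
      have hta : t ≤ a := by rw [ha]; grind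
      have hab : a ≤ b := by rw [ha, hb]; push_cast; grind
      have hbT : b ≤ T := min_le_left _ _
      have hd : b - a < δ := by rw [ha, hb]; push_cast; grind
      have h1 := hu b ⟨hta.trans hab, hbT⟩ a ⟨hta, hab.trans hbT⟩ (by
        rw [Real.dist_eq, abs_of_nonneg (by linarith)]; exact hd)
      rw [c_split hc ht hta hab hbT, Real.dist_eq, add_sub_cancel_left] at h1
      have h2 := (le_abs_self _).trans h1.le
      have h3 := norm_step hh ht hc hy hta hab hbT
      have h4 := hR y hy
      have h5 := norm_nonneg (stopPath b y)
      nlinarith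
  obtain ⟨k, hk⟩ := exists_nat_gt ((T - t) / (δ / 2))
  obtain ⟨R, hR⟩ := key k
  refine ⟨R, fun y hy => ?_⟩
  have := hR y hy
  rw [div_lt_iff₀ (by positivity)] at hk
  rwa [min_eq_left (by linarith), stop_T hh] at this

lemma isCompact_KSet {n : ℕ} {h T : ℝ} {t : ℝ} (hh : 0 ≤ h) (ht : 0 ≤ t) (htT : t ≤ T)
    (x : PathSp n h T)
    {c : ℝ → ℝ} (hc : IntegNonneg T c) : IsCompact (KSet t x c) := by
  obtain ⟨R, hR⟩ := KSet_bdd hh ht htT x hc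
  let I := ContinuousMap.isometryEquivBoundedOfCompact (Icc (-h) T) (Euc n)
  have hcl : IsClosed (I '' KSet t x c) :=
    I.toHomeomorph.isClosedMap _ (isClosed_KSet x c)
  have hcomp : IsCompact (I '' KSet t x c) := by
    refine BoundedContinuousFunction.arzela_ascoli₂ (Metric.closedBall 0 R)
      (isCompact_closedBall _ _) _ hcl ?_ ?_
    · rintro _ r ⟨y, hy, rfl⟩
      rw [mem_closedBall_zero_iff]
      exact (y.norm_coe_le_norm r).trans (hR y hy)
    · intro r₀
      have hC := (c_int hc ht htT le_rfl).absolutelyContinuousOnInterval_intervalIntegral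
        (c := t) left_mem_uIcc
      have hC2 := hC.continuousOn
      rw [uIcc_of_le htT] at hC2
      have hm : ∀ r : Icc (-h) T, max r.1 t ∈ Icc t T := fun r =>
        ⟨le_max_right _ _, max_le r.2.2 htT⟩
      have hm' : ∀ r : Icc (-h) T, min r.1 t ∈ Icc (-h) T := fun r =>
        ⟨le_min r.2.1 (by linarith), (min_le_right _ _).trans htT⟩
      have hCc : Continuous (fun r : Icc (-h) T => ∫ ξ in t..(max r.1 t), c ξ) :=
        hC2.comp_continuous (by fun_prop) hm
      let B : Icc (-h) T → ℝ := fun r => ‖evalP x (min r₀.1 t) - evalP x (min r.1 t)‖ +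
        (1 + R) * |(∫ ξ in t..(max r₀.1 t), c ξ) - ∫ ξ in t..(max r.1 t), c ξ|
      have hB : Continuous B := by
        have := (continuous_evalP x).comp
          (continuous_subtype_val.min continuous_const : Continuous fun r : Icc (-h) T =>
            min r.1 t)
        exact (continuous_const.sub this).norm.add
          (continuous_const.mul (continuous_const.sub hCc).abs)
      have hB0 : Tendsto B (𝓝 r₀) (𝓝 0) := by
        have := hB.tendsto r₀
        simpa [B] using this
      refine Metric.equicontinuousAt_of_continuity_modulus B hB0 _ (Eventually.of_forall ?_)
      rintro r ⟨_, y, hy, rfl⟩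
      change dist (y r₀) (y r) ≤ B r
      have dec : ∀ r : Icc (-h) T, y r = evalP x (min r.1 t) + evalP y (max r.1 t)
          - evalP y t := by
        intro r
        have h1 : evalP x (min r.1 t) = evalP y (min r.1 t) :=
          (evalP_congr hy.1 (hm' r) (min_le_right _ _)).symm
        rw [h1]
        have h2 : y r = evalP y r.1 := (evalP_eq y r.2).symm
        rw [h2]
        rcases le_total r.1 t with hl | hl
        · rw [min_eq_left hl, max_eq_right hl]; abel
        · rw [min_eq_right hl, max_eq_left hl]; abel
      have key : ∀ a b, t ≤ a → a ≤ b → b ≤ T → ‖evalP y a - evalP y b‖ ≤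
          (1 + R) * |(∫ ξ in t..a, c ξ) - (∫ ξ in t..b, c ξ)| := by
        intro a b hta hab hbT
        have h1 := hy.2 a b hta hab hbT
        have h2 := c_split hc ht hta hab hbT
        have h3 := c_nonneg hc (ht.trans hta) hab hbT
        have h4 := (norm_stop_le y b).trans (hR y hy)
        rw [h2, norm_sub_rev, abs_sub_comm, add_sub_cancel_left, abs_of_nonneg h3]
        nlinarith
      have key2 : ‖evalP y (max r₀.1 t) - evalP y (max r.1 t)‖ ≤
          (1 + R) * |(∫ ξ in t..(max r₀.1 t), c ξ) - (∫ ξ in t..(max r.1 t), c ξ)| := by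
        rcases le_total (max r₀.1 t) (max r.1 t) with hl | hl
        · exact key _ _ (hm r₀).1 hl (hm r).2
        · rw [norm_sub_rev, abs_sub_comm]
          exact key _ _ (hm r).1 hl (hm r₀).2
      rw [dist_eq_norm, dec r₀, dec r]
      have e : evalP x (min r₀.1 t) + evalP y (max r₀.1 t) - evalP y t -
          (evalP x (min r.1 t) + evalP y (max r.1 t) - evalP y t) =
          (evalP x (min r₀.1 t) - evalP x (min r.1 t)) +
          (evalP y (max r₀.1 t) - evalP y (max r.1 t)) := by abel
      rw [e]
      exact (norm_add_le _ _).trans (add_le_add le_rfl key2)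
  have := I.toHomeomorph.isCompact_image (s := KSet t x c)
  exact this.1 hcomp

lemma KSet_trans {n : ℕ} {h T : ℝ} {t b : ℝ} (hh : 0 ≤ h) (ht : 0 ≤ t) (htb : t ≤ b)
    {x y z : PathSp n h T} {c : ℝ → ℝ} (hc : IntegNonneg T c)
    (hy : y ∈ KSet t x c) (hz : z ∈ KSet b y c) : z ∈ KSet t x c := by
  refine ⟨(stop_congr hz.1 htb).trans hy.1, fun u v htu huv hvT => ?_⟩
  have h1 : ∀ u v, t ≤ u → u ≤ v → v ≤ T → v ≤ b →
      ‖evalP z v - evalP z u‖ ≤ (∫ ξ in u..v, c ξ) * (1 + ‖stopPath v z‖) := by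
    intro u v htu huv hvT hvb
    rw [evalP_congr hz.1 ⟨by linarith, by linarith⟩ hvb,
      evalP_congr hz.1 ⟨by linarith, by linarith⟩ (huv.trans hvb), stop_congr hz.1 hvb]
    exact hy.2 u v htu huv hvT
  rcases le_total v b with hvb | hvb
  · exact h1 u v htu huv hvT hvb
  rcases le_total b u with hbu | hbu
  · exact hz.2 u v hbu huv hvT
  have h2 := h1 u b htu hbu (hvb.trans hvT) le_rfl
  have h3 := hz.2 b v le_rfl hvb hvT
  have h4 := c_split hc (ht.trans htu) hbu hvb hvT
  have h5 := c_nonneg hc (ht.trans htu) hbu (hvb.trans hvT)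
  have h6 := norm_stop_mono z hvb
  have h7 : evalP z v - evalP z u = (evalP z v - evalP z b) + (evalP z b - evalP z u) := by abel
  rw [h7, h4]
  have h8 := norm_add_le (evalP z v - evalP z b) (evalP z b - evalP z u)
  nlinarith

lemma self_mem_KSet {n : ℕ} {h T : ℝ} {t : ℝ} (hh : 0 ≤ h) (ht : 0 ≤ t) (htT : t ≤ T)
    (x : PathSp n h T) {c : ℝ → ℝ} (hc : IntegNonneg T c) : stopPath t x ∈ KSet t x c := by
  refine ⟨stop_stop x le_rfl, fun u v htu huv hvT => ?_⟩
  have h1 : ∀ u, t ≤ u → u ≤ T → evalP (stopPath t x) u = evalP x t := by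
    intro u htu huT
    rw [evalP_eq _ (⟨by linarith, huT⟩ : u ∈ Icc (-h) T),
      evalP_eq _ (⟨by linarith, htT⟩ : t ∈ Icc (-h) T)]
    change x (stopTime h T t _) = _
    congr 1
    apply Subtype.ext
    simp only [stopTime]
    grind
  rw [h1 u htu (huv.trans hvT), h1 v (htu.trans huv) hvT, sub_self, norm_zero]
  have := c_nonneg hc (ht.trans htu) huv hvT
  positivity

lemma int_eq {n : ℕ} {h T : ℝ} {t : ℝ} (ht : 0 ≤ t) {x : PathSp n h T}
    {c : ℝ → ℝ} {p : PathSp n h T × (ℝ → Euc n)} (hp : p ∈ YPair t x c)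
    (s : Euc n) {g : ℝ → ℝ} (hg : IntegrableOn g (Icc 0 T)) {τ : ℝ} (hτ : τ ∈ Icc t T) :
    ∫ ξ in t..τ, (@inner ℝ _ _ s (p.2 ξ) - g ξ) =
      @inner ℝ _ _ s (evalP p.1 τ - evalP p.1 t) - ∫ ξ in t..τ, g ξ := by
  obtain ⟨⟨h1, h2, h3⟩, h4⟩ := hp
  have hi : IntervalIntegrable p.2 volume t τ := by
    apply h2.mono_set
    rw [uIcc_of_le hτ.1, uIcc_of_le (hτ.1.trans hτ.2)]
    exact Icc_subset_Icc le_rfl hτ.2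
  have hgi : IntervalIntegrable g volume t τ := by
    rw [intervalIntegrable_iff_integrableOn_Ioc_of_le hτ.1]
    exact hg.mono_set (fun r hr => ⟨ht.trans hr.1.le, hr.2.trans hτ.2⟩)
  have e : evalP p.1 τ - evalP p.1 t = ∫ ξ in t..τ, p.2 ξ := by
    rw [h3 τ hτ]; abel
  have h5 : IntervalIntegrable (fun ξ => @inner ℝ _ _ s (p.2 ξ)) volume t τ := by
    rw [intervalIntegrable_iff_integrableOn_Ioc_of_le hτ.1] at hi ⊢
    exact hi.const_inner s
  have h6 : ∫ ξ in t..τ, @inner ℝ _ _ s (p.2 ξ) = @inner ℝ _ _ s (∫ ξ in t..τ, p.2 ξ) :=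
    (innerSL ℝ s).intervalIntegral_comp_comm hi
  rw [intervalIntegral.integral_sub h5 hgi, h6, e]

/-- The value functional along a path. -/
def J {n : ℕ} {h T : ℝ} (G : ℝ → PathSp n h T → ℝ) (φ : ℝ → PathSp n h T → ℝ) (s : Euc n)
    (t τ : ℝ) (y : PathSp n h T) : ℝ :=
  φ τ y - (@inner ℝ _ _ s (evalP y τ - evalP y t) - ∫ ξ in t..τ, G ξ y)

/-- Regularity of the integrand. -/
structure GoodG {n : ℕ} {h T : ℝ} (G : ℝ → PathSp n h T → ℝ) : Prop where
  int : ∀ y, IntegrableOn (fun ξ => G ξ y) (Icc 0 T)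
  lip : ∀ D : Set (PathSp n h T), IsCompact D → ∃ lam : ℝ → ℝ, IntegNonneg T lam ∧
    ∀ y ∈ D, ∀ z ∈ D, ∀ᵐ ξ ∂(volume.restrict (Icc 0 T)),
      |G ξ y - G ξ z| ≤ lam ξ * ‖stopPath ξ y - stopPath ξ z‖

lemma GoodG.ii {n : ℕ} {h T : ℝ} {G : ℝ → PathSp n h T → ℝ} (hG : GoodG G) {a b : ℝ}
    (ha : 0 ≤ a) (hab : a ≤ b) (hb : b ≤ T) (y : PathSp n h T) :
    IntervalIntegrable (fun ξ => G ξ y) volume a b := by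
  rw [intervalIntegrable_iff_integrableOn_Ioc_of_le hab]
  exact (hG.int y).mono_set (fun r hr => ⟨ha.trans hr.1.le, hr.2.trans hb⟩)

lemma GoodG.congr {n : ℕ} {h T : ℝ} {G : ℝ → PathSp n h T → ℝ} (hG : GoodG G) {a b : ℝ}
    (ha : 0 ≤ a) (hab : a ≤ b) (hb : b ≤ T) {y z : PathSp n h T}
    (hyz : stopPath b y = stopPath b z) :
    ∫ ξ in a..b, G ξ y = ∫ ξ in a..b, G ξ z := by
  obtain ⟨lam, -, h2⟩ := hG.lip {y, z} (Set.toFinite _).isCompact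
  have h3 := h2 y (by simp) z (by simp)
  rw [ae_restrict_iff' measurableSet_Icc] at h3
  refine intervalIntegral.integral_congr_ae ?_
  filter_upwards [h3] with ξ hξ hm
  rw [uIoc_of_le hab] at hm
  have := hξ ⟨ha.trans hm.1.le, hm.2.trans hb⟩
  rw [stop_congr hyz hm.2, sub_self, norm_zero, mul_zero] at this
  exact sub_eq_zero.1 (abs_nonpos_iff.1 this)

lemma GoodG.cont {n : ℕ} {h T : ℝ} {G : ℝ → PathSp n h T → ℝ} (hG : GoodG G) {a b : ℝ}
    (ha : 0 ≤ a) (hab : a ≤ b) (hb : b ≤ T) {D : Set (PathSp n h T)} (hD : IsCompact D) :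
    ContinuousOn (fun y => ∫ ξ in a..b, G ξ y) D := by
  obtain ⟨lam, h1, h2⟩ := hG.lip D hD
  have key : ∀ y ∈ D, ∀ z ∈ D, dist (∫ ξ in a..b, G ξ y) (∫ ξ in a..b, G ξ z) ≤
      (∫ ξ in a..b, lam ξ) * dist y z := by
    intro y hy z hz
    rw [dist_eq_norm, ← intervalIntegral.integral_sub (hG.ii ha hab hb y) (hG.ii ha hab hb z),
      ← intervalIntegral.integral_mul_const]
    refine intervalIntegral.norm_integral_le_of_norm_le hab ?_
      ((c_int h1 ha hab hb).mul_const _)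
    have h3 := h2 y hy z hz
    rw [ae_restrict_iff' measurableSet_Icc] at h3
    filter_upwards [h3] with ξ hξ hm
    have hm' : ξ ∈ Icc 0 T := ⟨ha.trans hm.1.le, hm.2.trans hb⟩
    refine (hξ hm').trans ?_
    have := h1.2 ξ hm'
    rw [stop_sub, dist_eq_norm]
    gcongr
    exact norm_stop_le _ _
  have hL := c_nonneg h1 ha hab hb
  exact (LipschitzOnWith.of_dist_le_mul (K := ⟨_, hL⟩) key).continuousOn

lemma J_congr {n : ℕ} {h T : ℝ} (hh : 0 ≤ h) {G : ℝ → PathSp n h T → ℝ} (hG : GoodG G)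
    {φ : ℝ → PathSp n h T → ℝ} (hna : NonAnticipative φ) (s : Euc n)
    {t τ : ℝ} (ht : 0 ≤ t) (htτ : t ≤ τ) (hτ : τ ≤ T) {y z : PathSp n h T}
    (hyz : stopPath τ y = stopPath τ z) : J G φ s t τ y = J G φ s t τ z := by
  unfold J
  rw [hna τ ⟨ht.trans htτ, hτ⟩ y, hna τ ⟨ht.trans htτ, hτ⟩ z, hyz,
    evalP_congr hyz ⟨by linarith, hτ⟩ le_rfl, evalP_congr hyz ⟨by linarith, by linarith⟩ htτ,
    hG.congr ht htτ hτ hyz]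

lemma core_finite {n : ℕ} {h T : ℝ} (hh : 0 ≤ h)
    {c : ℝ → ℝ} (hc : IntegNonneg T c)
    {G : ℝ → PathSp n h T → ℝ} (hG : GoodG G)
    {φ : ℝ → PathSp n h T → ℝ} (hna : NonAnticipative φ) (s : Euc n)
    (hU : ∀ t ∈ Ico (0:ℝ) T, ∀ x : PathSp n h T, ∀ τ ∈ Ioc t T,
      ∃ y ∈ KSet t x c, J G φ s t τ y ≤ φ t x)
    {t : ℝ} (ht : 0 ≤ t) (htT : t ≤ T) (x : PathSp n h T) (S : Finset ℝ) :
    (∀ τ ∈ S, τ ∈ Ioc t T) → ∃ y ∈ KSet t x c, ∀ τ ∈ S, J G φ s t τ y ≤ φ t x := by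
  induction S using Finset.induction_on_max with
  | empty => exact fun _ => ⟨_, self_mem_KSet hh ht htT x hc, by simp⟩
  | insert a S hmax ih =>
    intro hS
    have ha := hS a (Finset.mem_insert_self _ _)
    obtain ⟨y, hy, hyS⟩ := ih (fun τ hτ => hS τ (Finset.mem_insert_of_mem hτ))
    have hb : ∃ b, t ≤ b ∧ b < a ∧ (∀ τ ∈ S, τ ≤ b) ∧ J G φ s t b y ≤ φ t x := by
      rcases S.eq_empty_or_nonempty with rfl | hne
      · refine ⟨t, le_rfl, ha.1, by simp, ?_⟩
        have h1 := hna t ⟨ht, htT⟩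
        simp [J, h1 y, hy.1, ← h1 x]
      · have hm := S.max'_mem hne
        exact ⟨S.max' hne, (hS _ (Finset.mem_insert_of_mem hm)).1.le, hmax _ hm,
          fun τ hτ => S.le_max' τ hτ, hyS _ hm⟩
    obtain ⟨b, htb, hba, hbS, hJb⟩ := hb
    have hbT : b ≤ T := hba.le.trans ha.2
    obtain ⟨z, hz, hJz⟩ := hU b ⟨ht.trans htb, hba.trans_le ha.2⟩ y a ⟨hba, ha.2⟩
    refine ⟨z, KSet_trans hh ht htb hc hy hz, fun τ hτ => ?_⟩
    rcases Finset.mem_insert.1 hτ with rfl | hτS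
    · have h1 := J_congr hh hG hna s ht htb hbT hz.1
      have h2 := intervalIntegral.integral_add_adjacent_intervals
        (hG.ii ht htb hbT z) (hG.ii (ht.trans htb) hba.le ha.2 z)
      have h3 : φ b z = φ b y := by
        rw [hna b ⟨ht.trans htb, hbT⟩ z, hz.1, ← hna b ⟨ht.trans htb, hbT⟩ y]
      have h4 : evalP z τ - evalP z t = (evalP z τ - evalP z b) + (evalP z b - evalP z t) := by
        abel
      rw [← h1] at hJb
      unfold J at hJb hJz ⊢
      rw [h4, inner_add_right, ← h2]
      linarith
    · have hτ1 := hS τ hτ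
      rw [J_congr hh hG hna s ht hτ1.1.le hτ1.2 (stop_congr hz.1 (hbS τ hτS))]
      exact hyS τ hτS

lemma core {n : ℕ} {h T : ℝ} (hh : 0 ≤ h)
    {c : ℝ → ℝ} (hc : IntegNonneg T c)
    {G : ℝ → PathSp n h T → ℝ} (hG : GoodG G)
    {φ : ℝ → PathSp n h T → ℝ} (hna : NonAnticipative φ) (s : Euc n)
    (hlsc : LowerSemicontinuousOn (fun p : ℝ × PathSp n h T => φ p.1 p.2)
        (Set.Icc 0 T ×ˢ (Set.univ : Set (PathSp n h T))))
    (hU : ∀ t ∈ Ico (0:ℝ) T, ∀ x : PathSp n h T, ∀ τ ∈ Ioc t T,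
      ∃ p ∈ YPair t x c,
        φ τ p.1 - ∫ ξ in t..τ, (@inner ℝ _ _ s (p.2 ξ) - G ξ p.1) ≤ φ t x)
    {t : ℝ} (ht : t ∈ Ico (0:ℝ) T) (x : PathSp n h T) :
    ∃ p ∈ YPair t x c, ∀ τ ∈ Ioc t T,
        φ τ p.1 - ∫ ξ in t..τ, (@inner ℝ _ _ s (p.2 ξ) - G ξ p.1) ≤ φ t x := by
  have hU' : ∀ t ∈ Ico (0:ℝ) T, ∀ x : PathSp n h T, ∀ τ ∈ Ioc t T,
      ∃ y ∈ KSet t x c, J G φ s t τ y ≤ φ t x := by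
    intro t ht x τ hτ
    obtain ⟨p, hp, hle⟩ := hU t ht x τ hτ
    refine ⟨p.1, YPair_sub_KSet ht.1 hc hp, ?_⟩
    rwa [int_eq ht.1 hp s (hG.int p.1) ⟨hτ.1.le, hτ.2⟩] at hle
  have hK := isCompact_KSet hh ht.1 ht.2.le x hc
  let F : Ioc t T → Set (PathSp n h T) := fun τ =>
    KSet t x c ∩ (J G φ s t τ) ⁻¹' Iic (φ t x)
  have hF : ∀ τ, IsClosed (F τ) := by
    intro τ
    have hτ0 : (τ : ℝ) ∈ Icc 0 T := ⟨ht.1.trans τ.2.1.le, τ.2.2⟩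
    have h1 : LowerSemicontinuousOn (fun y => φ τ y) (KSet t x c) := by
      intro y hy r hr
      have h2 := hlsc (τ.1, y) ⟨hτ0, mem_univ _⟩ r hr
      have h3 : Tendsto (fun z : PathSp n h T => (τ.1, z)) (𝓝[KSet t x c] y)
          (𝓝[Icc 0 T ×ˢ univ] (τ.1, y)) := by
        refine tendsto_nhdsWithin_iff.2 ⟨?_, Eventually.of_forall fun z => ⟨hτ0, mem_univ _⟩⟩
        exact (Continuous.tendsto (by fun_prop) y).mono_left nhdsWithin_le_nhds
      exact h3.eventually h2
    have h2 : ContinuousOn (fun y : PathSp n h T =>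
        -(@inner ℝ _ _ s (evalP y τ - evalP y t) - ∫ ξ in t..τ, G ξ y)) (KSet t x c) := by
      refine (ContinuousOn.sub ?_ (hG.cont ht.1 τ.2.1.le τ.2.2 hK)).neg
      exact (continuous_const.inner
        (continuous_evalP_path.sub continuous_evalP_path)).continuousOn
    have h3 : LowerSemicontinuousOn (J G φ s t τ) (KSet t x c) := by
      have := h1.add h2.lowerSemicontinuousOn
      simpa only [J, sub_eq_add_neg] using! this
    exact (h3.isCompact_inter_preimage_Iic hK _).isClosed
  obtain ⟨y, hyK, hyF⟩ := hK.inter_iInter_nonempty F hF (by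
    intro u
    obtain ⟨y, hy, hyS⟩ := core_finite hh hc hG hna s hU' ht.1 ht.2.le x
      (u.image Subtype.val) (by
        intro τ hτ
        obtain ⟨a, -, rfl⟩ := Finset.mem_image.1 hτ
        exact a.2)
    refine ⟨y, hy, ?_⟩
    simp only [mem_iInter]
    exact fun τ hτ => ⟨hy, hyS _ (Finset.mem_image_of_mem _ hτ)⟩)
  obtain ⟨y', hp⟩ := KSet_sub_YSet hh ht.1 ht.2.le hc hyK
  refine ⟨(y, y'), hp, fun τ hτ => ?_⟩
  have := (mem_iInter.1 hyF ⟨τ, hτ⟩).2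
  rw [int_eq ht.1 hp s (hG.int y) ⟨hτ.1.le, hτ.2⟩]
  exact this

lemma ae_of_full {T : ℝ} {f g : ℝ → ℝ}
    (hf : AEMeasurable f (volume.restrict (Icc 0 T)))
    (hg : AEMeasurable g (volume.restrict (Icc 0 T))) {E : Set ℝ} (hE : E ⊆ Icc 0 T)
    (hv : volume E = ENNReal.ofReal T) (hle : ∀ t ∈ E, f t ≤ g t) :
    ∀ᵐ t ∂(volume.restrict (Icc 0 T)), f t ≤ g t := by
  have hm : NullMeasurableSet {t | f t ≤ g t} (volume.restrict (Icc 0 T)) :=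
    nullMeasurableSet_le hf hg
  have hfin : IsFiniteMeasure (volume.restrict (Icc (0:ℝ) T)) := by infer_instance
  have h1 : volume.restrict (Icc 0 T) E = ENNReal.ofReal T := by
    rw [Measure.restrict_apply' measurableSet_Icc, inter_eq_left.2 hE, hv]
  have h2 : volume.restrict (Icc 0 T) univ = ENNReal.ofReal T := by
    rw [Measure.restrict_apply_univ, Real.volume_Icc, sub_zero]
  have h3 : volume.restrict (Icc 0 T) {t | f t ≤ g t} = volume.restrict (Icc 0 T) univ := by
    refine le_antisymm (measure_mono (subset_univ _)) ?_
    rw [h2, ← h1]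
    exact measure_mono hle
  have := measure_compl₀ hm (measure_ne_top _ _)
  rw [h3, tsub_self] at this
  exact this

lemma meas_stop {n : ℕ} {h T : ℝ} (y : PathSp n h T) : Measurable (fun t => ‖stopPath t y‖) :=
  (continuous_stop_time y).norm.measurable

lemma goodG_of_condA {n : ℕ} {h T : ℝ} {H : ℝ → PathSp n h T → Euc n → ℝ} {c : ℝ → ℝ}
    (hH : CondA H c) (s : Euc n) : GoodG (fun ξ y => H ξ y s) := by
  obtain ⟨A1, -, A3, A4, A5⟩ := hH
  have hmeas : ∀ y s, AEMeasurable (fun t => H t y s) (volume.restrict (Icc 0 T)) := by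
    intro y s
    exact aemeasurable_restrict_of_measurable_subtype measurableSet_Icc (A1 y s)
  have hiff : ∀ {l : ℝ → ℝ}, IntegNonneg T l → AEMeasurable l (volume.restrict (Icc 0 T)) :=
    fun hl => hl.1.aemeasurable
  refine ⟨fun y => ?_, fun D hD => ?_⟩
  · obtain ⟨m, hm, h5⟩ := A5 {y} isCompact_singleton
    obtain ⟨E5, hE5, hv5, hle5⟩ := h5 y rfl
    obtain ⟨hc, E4, hE4, hv4, hle4⟩ := A4
    have b5 := ae_of_full (hmeas y 0).abs (hiff hm) hE5 hv5 hle5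
    have b4 := ae_of_full ((hmeas y s).sub (hmeas y 0)).abs
      (((hiff hc).mul ((meas_stop y).const_add 1).aemeasurable).mul_const ‖s - 0‖) hE4 hv4
      (fun t ht => hle4 t ht y s 0)
    refine Integrable.mono' (g := fun t => m t + c t * ((1 + ‖y‖) * ‖s - 0‖))
      (hm.1.add (hc.1.mul_const _)) (hmeas y s).aestronglyMeasurable ?_
    filter_upwards [b5, b4, ae_restrict_mem measurableSet_Icc] with t h1 h2 h3
    have h4 := hc.2 t h3
    have h5 := norm_stop_le y t
    have h6 : c t * (1 + ‖stopPath t y‖) * ‖s - 0‖ ≤ c t * ((1 + ‖y‖) * ‖s - 0‖) := by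
      rw [mul_assoc]; gcongr
    simp only [Pi.mul_apply, Pi.sub_apply] at h2
    rw [Real.norm_eq_abs]
    have h7 := abs_sub_abs_le_abs_sub (H t y s) (H t y 0)
    linarith
  · obtain ⟨lam, hl, hle⟩ := A3 D hD
    refine ⟨fun t => lam t * (1 + ‖s‖), ⟨hl.1.mul_const _, fun τ hτ => ?_⟩, fun y hy z hz => ?_⟩
    · have := hl.2 τ hτ
      positivity
    · obtain ⟨E, hE, hv, hb⟩ := hle y hy z hz s
      refine ae_of_full ((hmeas y s).sub (hmeas z s)).abs
        (((hiff hl).mul_const _).mul ?_) hE hv hb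
      simp_rw [stop_sub]
      exact (meas_stop _).aemeasurable

lemma GoodG.neg {n : ℕ} {h T : ℝ} {G : ℝ → PathSp n h T → ℝ} (hG : GoodG G) :
    GoodG (fun ξ y => -G ξ y) := by
  refine ⟨fun y => (hG.int y).neg, fun D hD => ?_⟩
  obtain ⟨lam, h1, h2⟩ := hG.lip D hD
  refine ⟨lam, h1, fun y hy z hz => ?_⟩
  filter_upwards [h2 y hy z hz] with ξ hξ
  rwa [← neg_sub', abs_neg]

end S7

/-- Lemma on strengthened properties (U) and (L): for
non-anticipative `φ`, lower semicontinuity and (U) give a single `y(·)` working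
for all `τ ∈ (t,T]`, and symmetrically for (L). -/
theorem stmt7 {n : ℕ} {h T : ℝ} (hT : 0 < T) (hh : 0 ≤ h)
    (H : ℝ → PathSp n h T → Euc n → ℝ) (cH : ℝ → ℝ) (hH : CondA H cH)
    (σ : PathSp n h T → ℝ) (hσ : Continuous σ)
    (φ : ℝ → PathSp n h T → ℝ) (hna : NonAnticipative φ) :
    ((LowerSemicontinuousOn (fun p : ℝ × PathSp n h T => φ p.1 p.2)
        (Set.Icc 0 T ×ˢ (Set.univ : Set (PathSp n h T))) ∧ PropU H cH φ) →
      ∀ t ∈ Set.Ico (0:ℝ) T, ∀ x : PathSp n h T, ∀ s : Euc n,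
        ∃ p ∈ YPair t x cH, ∀ τ ∈ Set.Ioc t T,
          φ τ p.1 - ∫ ξ in t..τ, (@inner ℝ _ _ s (p.2 ξ) - H ξ p.1 s) ≤ φ t x) ∧
    ((UpperSemicontinuousOn (fun p : ℝ × PathSp n h T => φ p.1 p.2)
        (Set.Icc 0 T ×ˢ (Set.univ : Set (PathSp n h T))) ∧ PropL H cH φ) →
      ∀ t ∈ Set.Ico (0:ℝ) T, ∀ x : PathSp n h T, ∀ s : Euc n,
        ∃ p ∈ YPair t x cH, ∀ τ ∈ Set.Ioc t T,
          φ t x ≤ φ τ p.1 - ∫ ξ in t..τ, (@inner ℝ _ _ s (p.2 ξ) - H ξ p.1 s)) := by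
  have hc := hH.2.2.2.1.1
  refine ⟨fun ⟨h1, h2⟩ t ht x s => ?_, fun ⟨h1, h2⟩ t ht x s => ?_⟩
  · exact S7.core hh hc (S7.goodG_of_condA hH s) hna s h1 (fun t ht x τ hτ => h2 t ht x s τ hτ) ht x
  · have e : ∀ (t τ : ℝ) (p : PathSp n h T × (ℝ → Euc n)),
        ∫ ξ in t..τ, (@inner ℝ _ _ (-s) (p.2 ξ) - -H ξ p.1 s) =
        -∫ ξ in t..τ, (@inner ℝ _ _ s (p.2 ξ) - H ξ p.1 s) := by
      intro t τ p
      rw [← intervalIntegral.integral_neg]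
      congr 1
      ext ξ
      rw [inner_neg_left]
      ring
    have hna' : NonAnticipative (fun t x => -φ t x) := fun t ht x => by
      simp only [neg_inj]
      exact hna t ht x
    have hl : LowerSemicontinuousOn (fun p : ℝ × PathSp n h T => -φ p.1 p.2)
        (Set.Icc 0 T ×ˢ (Set.univ : Set (PathSp n h T))) := by
      intro y hy r hr
      filter_upwards [h1 y hy (-r) (by linarith)] with z hz
      linarith
    obtain ⟨p, hp, hle⟩ := S7.core hh hc (S7.goodG_of_condA hH s).neg hna' (-s) hl
      (fun t ht x τ hτ => by
        obtain ⟨p, hp, hle⟩ := h2 t ht x s τ hτ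
        refine ⟨p, hp, ?_⟩
        rw [e]
        linarith) ht x
    refine ⟨p, hp, fun τ hτ => ?_⟩
    have := hle τ hτ
    rw [e] at this
    linarith

end
end

section
/- Suppose H : [0,T] × C × ℝⁿ → ℝ satisfies conditions (A.1)–(A.5) and σ : C → ℝ satisfies (A.6), and let S ⊂ C be a union of countably many compact sets D_k ⊂ C, k ∈ ℕ. Then there exists a set E ⊂ [0,T) with μ(E) = T such that any minimax solution φ of the Cauchy problem satisfies ∂ₜφ(t,x(·)) + H(t,x(·),∇φ(t,x(·))) = 0 at every point (t,x(·)) ∈ E × S at which φ is ci-differentiable. -/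
open MeasureTheory Set Filter Topology

noncomputable section

attribute [local instance] Classical.propDecidable

/-! ### Basic facts on evaluation and stopping -/

lemma evalP_eq {n : ℕ} {h T : ℝ} (x : PathSp n h T) {τ : ℝ} (hτ : τ ∈ Set.Icc (-h) T) :
    evalP x τ = x ⟨τ, hτ⟩ := by
  have hc : -h ≤ T := hτ.1.trans hτ.2
  simp only [evalP, dif_pos hc]
  rw [Set.projIcc_of_mem hc hτ]

lemma evalP_sub {n : ℕ} {h T : ℝ} (x y : PathSp n h T) (τ : ℝ) :
    evalP (x - y) τ = evalP x τ - evalP y τ := by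
  unfold evalP
  split_ifs <;> simp

lemma continuous_evalP {n : ℕ} {h T : ℝ} (x : PathSp n h T) : Continuous (evalP x) := by
  unfold evalP
  split_ifs with hc
  · exact x.continuous.comp continuous_projIcc
  · exact continuous_const

lemma evalP_stopPath {n : ℕ} {h T : ℝ} (x : PathSp n h T) {τ t : ℝ} (hh : 0 ≤ h) (ht : 0 ≤ t)
    (hτ : τ ∈ Set.Icc (-h) T) : evalP (stopPath t x) τ = evalP x (min τ t) := by
  have h1 : min τ t ∈ Set.Icc (-h) T :=
    ⟨le_min hτ.1 (by linarith), (min_le_left _ _).trans hτ.2⟩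
  rw [evalP_eq _ hτ, evalP_eq _ h1]
  simp only [stopPath, ContinuousMap.comp_apply, ContinuousMap.coe_mk, stopTime]
  congr 1
  ext
  simp [h1.1]

lemma norm_evalP_le {n : ℕ} {h T : ℝ} (x : PathSp n h T) (τ : ℝ) : ‖evalP x τ‖ ≤ ‖x‖ := by
  unfold evalP
  split_ifs with hc
  · exact x.norm_coe_le_norm _
  · simp

lemma norm_le_of_evalP {n : ℕ} {h T : ℝ} (x : PathSp n h T) {d : ℝ} (hd : 0 ≤ d)
    (H : ∀ τ ∈ Set.Icc (-h) T, ‖evalP x τ‖ ≤ d) : ‖x‖ ≤ d := by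
  rw [ContinuousMap.norm_le _ hd]
  intro τ
  have := H τ.1 τ.2
  rwa [evalP_eq _ τ.2] at this

lemma norm_stopPath_le {n : ℕ} {h T : ℝ} (x : PathSp n h T) (t : ℝ) :
    ‖stopPath t x‖ ≤ ‖x‖ := by
  rw [ContinuousMap.norm_le _ (norm_nonneg _)]
  intro τ
  exact x.norm_coe_le_norm _

lemma stopPath_sub {n : ℕ} {h T : ℝ} (x y : PathSp n h T) (t : ℝ) :
    stopPath t (x - y) = stopPath t x - stopPath t y := by
  ext; simp [stopPath]

lemma norm_evalP_le_stop {n : ℕ} {h T : ℝ} (hh : 0 ≤ h) (x : PathSp n h T) {τ t : ℝ}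
    (ht : t ∈ Set.Icc 0 T) (h1 : -h ≤ τ) (h2 : τ ≤ t) : ‖evalP x τ‖ ≤ ‖stopPath t x‖ := by
  have := norm_evalP_le (stopPath t x) τ
  rwa [evalP_stopPath x hh ht.1 ⟨h1, h2.trans ht.2⟩, min_eq_left h2] at this

lemma norm_stop_le_of_evalP {n : ℕ} {h T : ℝ} (hh : 0 ≤ h) (x : PathSp n h T) {t d : ℝ}
    (ht : 0 ≤ t) (hd : 0 ≤ d)
    (H : ∀ τ, -h ≤ τ → τ ≤ t → ‖evalP x τ‖ ≤ d) : ‖stopPath t x‖ ≤ d := by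
  refine norm_le_of_evalP _ hd fun τ hτ => ?_
  rw [evalP_stopPath x hh ht hτ]
  exact H _ (le_min hτ.1 (by linarith)) (min_le_right _ _)

lemma norm_stop_mono {n : ℕ} {h T : ℝ} (hh : 0 ≤ h) (x : PathSp n h T) {a b : ℝ}
    (ha : 0 ≤ a) (hab : a ≤ b) (hb : b ≤ T) : ‖stopPath a x‖ ≤ ‖stopPath b x‖ :=
  norm_stop_le_of_evalP hh x ha (norm_nonneg _) fun _ h1 h2 =>
    norm_evalP_le_stop hh x ⟨ha.trans hab, hb⟩ h1 (h2.trans hab)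

lemma stopPath_T {n : ℕ} {h T : ℝ} (x : PathSp n h T) : stopPath T x = x := by
  ext1 τ
  simp only [stopPath, ContinuousMap.comp_apply, ContinuousMap.coe_mk, stopTime]
  congr 1
  ext
  simp [τ.2.1, τ.2.2]

lemma continuous_stopPath_uncurry {n : ℕ} {h T : ℝ} :
    Continuous (fun q : ℝ × PathSp n h T => stopPath q.1 q.2) := by
  apply ContinuousMap.continuous_of_continuous_uncurry
  have h1 : Continuous (fun q : (ℝ × PathSp n h T) × Set.Icc (-h) T =>
      stopTime h T q.1.1 q.2) :=
    Continuous.subtype_mk (by fun_prop) _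
  have h2 : Continuous (fun q : (ℝ × PathSp n h T) × Set.Icc (-h) T =>
      (q.1.2 (stopTime h T q.1.1 q.2))) := by
    fun_prop
  exact h2

/-! ### Absolutely continuous extensions -/

lemma ac_eval_left {n : ℕ} {h T : ℝ} (hh : 0 ≤ h) {t : ℝ} (ht : t ∈ Set.Icc 0 T)
    {x : PathSp n h T} {p : PathSp n h T × (ℝ → Euc n)} (hp : p ∈ ACPair t x)
    {τ : ℝ} (h1 : -h ≤ τ) (h2 : τ ≤ t) : evalP p.1 τ = evalP x τ := by
  have e := congrArg (fun z => evalP z τ) hp.1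
  have hm : τ ∈ Set.Icc (-h) T := ⟨h1, h2.trans ht.2⟩
  simpa [evalP_stopPath _ hh ht.1 hm, min_eq_left h2] using e

lemma ac_eval_right {n : ℕ} {h T : ℝ} (hh : 0 ≤ h) {t : ℝ} (ht : t ∈ Set.Icc 0 T)
    {x : PathSp n h T} {p : PathSp n h T × (ℝ → Euc n)} (hp : p ∈ ACPair t x)
    {τ : ℝ} (h1 : t ≤ τ) (h2 : τ ≤ T) : evalP p.1 τ = evalP x t + ∫ ξ in t..τ, p.2 ξ := by
  rw [hp.2.2 τ ⟨h1, h2⟩, ac_eval_left hh ht hp (by linarith [ht.1]) le_rfl]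

lemma ac_ii {n : ℕ} {h T : ℝ} {t : ℝ} 
    {x : PathSp n h T} {p : PathSp n h T × (ℝ → Euc n)} (hp : p ∈ ACPair t x)
    {a b : ℝ} (h1 : t ≤ a) (h2 : a ≤ b) (h3 : b ≤ T) : IntervalIntegrable p.2 volume a b :=
  hp.2.1.mono_set (by
    rw [uIcc_of_le h2, uIcc_of_le (h1.trans (h2.trans h3))]
    exact Icc_subset_Icc h1 h3)

lemma ac_eval_diff {n : ℕ} {h T : ℝ} (hh : 0 ≤ h) {t : ℝ} (ht : t ∈ Set.Icc 0 T)
    {x : PathSp n h T} {p : PathSp n h T × (ℝ → Euc n)} (hp : p ∈ ACPair t x)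
    {a b : ℝ} (h1 : t ≤ a) (h2 : a ≤ b) (h3 : b ≤ T) :
    evalP p.1 b = evalP p.1 a + ∫ ξ in a..b, p.2 ξ := by
  rw [ac_eval_right hh ht hp h1 (h2.trans h3), ac_eval_right hh ht hp (h1.trans h2) h3, add_assoc,
    intervalIntegral.integral_add_adjacent_intervals (ac_ii hp le_rfl h1 (h2.trans h3))
      (ac_ii hp h1 h2 h3)]

/-- Bound for the increment integral. -/
lemma int_le_of_ae {n : ℕ} {t T : ℝ} {q : ℝ → Euc n} {c : ℝ → ℝ} (hc : Integrable c)
    {M : ℝ} {a b : ℝ} (hM : ∀ᵐ ξ ∂(volume.restrict (Set.Icc t T)), ξ ≤ b → ‖q ξ‖ ≤ M * c ξ)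
    (h1 : t ≤ a) (h2 : a ≤ b) (h3 : b ≤ T) :
    ‖∫ ξ in a..b, q ξ‖ ≤ M * ∫ ξ in a..b, c ξ := by
  rw [← intervalIntegral.integral_const_mul]
  refine intervalIntegral.norm_integral_le_of_norm_le h2 ?_
    ((hc.const_mul M).intervalIntegrable)
  have := (ae_restrict_iff' measurableSet_Icc).1 hM
  filter_upwards [this] with ξ hξ hξ2
  exact hξ ⟨h1.trans hξ2.1.le, hξ2.2.trans h3⟩ hξ2.2

lemma int_mono {c : ℝ → ℝ} (hc : Integrable c) (hc0 : ∀ ξ, 0 ≤ c ξ) {a a' b b' : ℝ}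
    (h1 : a' ≤ a) (h2 : a ≤ b) (h3 : b ≤ b') :
    ∫ ξ in a..b, c ξ ≤ ∫ ξ in a'..b', c ξ :=
  intervalIntegral.integral_mono_interval h1 h2 h3 (Eventually.of_forall hc0)
    hc.intervalIntegrable

lemma int_nonneg {c : ℝ → ℝ} (hc0 : ∀ ξ, 0 ≤ c ξ) {a b : ℝ} (h : a ≤ b) :
    0 ≤ ∫ ξ in a..b, c ξ :=
  intervalIntegral.integral_nonneg h (fun ξ _ => hc0 ξ)

/-- A Gronwall type bound. -/
lemma gronwall_bound {n : ℕ} {h T : ℝ} (hh : 0 ≤ h) {c : ℝ → ℝ}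
    (hc : Integrable c) (hc0 : ∀ ξ, 0 ≤ c ξ) :
    ∃ K : ℝ, 0 < K ∧ ∀ t ∈ Set.Icc (0:ℝ) T, ∀ x : PathSp n h T, ∀ p ∈ YPair t x c,
      1 + ‖p.1‖ ≤ K * (1 + ‖x‖) := by
  have hC : Continuous (fun τ => ∫ ξ in (0:ℝ)..τ, c ξ) :=
    intervalIntegral.continuous_primitive (fun a b => hc.intervalIntegrable) 0
  have huc := (isCompact_Icc (a := (0:ℝ)) (b := T)).uniformContinuousOn_of_continuous
    hC.continuousOn
  rw [Metric.uniformContinuousOn_iff] at huc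
  obtain ⟨δ, hδ, huc⟩ := huc (1/2) (by norm_num)
  have hsm : ∀ a b, 0 ≤ a → a ≤ b → b ≤ T → b - a ≤ δ / 2 → ∫ ξ in a..b, c ξ ≤ 1/2 := by
    intro a b ha hab hb hd
    have := huc a ⟨ha, hab.trans hb⟩ b ⟨ha.trans hab, hb⟩ (by
      rw [dist_comm, Real.dist_eq, abs_of_nonneg (by linarith)]; linarith)
    rw [dist_comm, Real.dist_eq, intervalIntegral.integral_interval_sub_left hc.intervalIntegrable
      hc.intervalIntegrable] at this
    exact (le_abs_self _).trans this.le
  obtain ⟨N, hN⟩ := exists_nat_ge (T / (δ/2))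
  refine ⟨2 ^ N, by positivity, ?_⟩
  intro t ht x p hp
  have step : ∀ a b, t ≤ a → a ≤ b → b ≤ T → b - a ≤ δ / 2 →
      1 + ‖stopPath b p.1‖ ≤ 2 * (1 + ‖stopPath a p.1‖) := by
    intro a b ha hab hb hd
    have h0 : (0:ℝ) ≤ a := ht.1.trans ha
    have hI := hsm a b h0 hab hb hd
    have hnn := int_nonneg hc0 hab
    have hm := norm_nonneg (stopPath b p.1)
    have key : ‖stopPath b p.1‖ ≤ ‖stopPath a p.1‖ +
        (1 + ‖stopPath b p.1‖) * ∫ ξ in a..b, c ξ := by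
      refine norm_stop_le_of_evalP hh _ (h0.trans hab) (by positivity) ?_
      intro τ h1 h2
      rcases le_total τ a with hτ | hτ
      · have := norm_evalP_le_stop hh p.1 ⟨h0, hab.trans hb⟩ h1 hτ
        have : 0 ≤ (1 + ‖stopPath b p.1‖) * ∫ ξ in a..b, c ξ := by positivity
        linarith
      · rw [ac_eval_diff hh ht hp.1 ha hτ (h2.trans hb)]
        refine (norm_add_le _ _).trans ?_
        have e1 := norm_evalP_le_stop hh p.1 (τ := a) ⟨h0, hab.trans hb⟩ (by linarith) le_rfl
        have e2 : ‖∫ ξ in a..τ, p.2 ξ‖ ≤ (1 + ‖stopPath b p.1‖) * ∫ ξ in a..τ, c ξ := by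
          refine int_le_of_ae (t := t) (T := T) hc ?_ ha hτ (h2.trans hb)
          filter_upwards [hp.2, ae_restrict_mem measurableSet_Icc] with ξ hξ hξm hξ2
          refine hξ.trans ?_
          rw [mul_comm]
          have := norm_stop_mono hh p.1 (ht.1.trans hξm.1) (hξ2.trans h2) hb
          exact mul_le_mul_of_nonneg_right (by linarith) (hc0 ξ)
        have e3 := int_mono hc hc0 (le_refl a) hτ h2
        have e4 := mul_le_mul_of_nonneg_left e3 (by linarith : 0 ≤ 1 + ‖stopPath b p.1‖)
        linarith
    nlinarith
  have ind : ∀ k : ℕ, ∀ b, t ≤ b → b ≤ T → b ≤ t + k * (δ/2) →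
      1 + ‖stopPath b p.1‖ ≤ 2 ^ k * (1 + ‖stopPath t p.1‖) := by
    intro k
    induction k with
    | zero =>
      intro b h1 h2 h3
      have : b = t := by simp at h3; linarith
      simp [this]
    | succ k ih =>
      intro b h1 h2 h3
      push_cast at h3
      have s := step (max t (b - δ/2)) b (le_max_left _ _) (max_le h1 (by linarith)) h2
        (by linarith [le_max_right t (b - δ/2)])
      have i := ih (max t (b - δ/2)) (le_max_left _ _) (max_le (h1.trans h2) (by linarith))
        (max_le (by nlinarith [(Nat.cast_nonneg k : (0:ℝ) ≤ k)]) (by linarith))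
      rw [pow_succ]
      linarith
  have fin := ind N T ht.2 le_rfl (by
    rw [div_le_iff₀ (by linarith)] at hN
    linarith [ht.1])
  rw [stopPath_T, hp.1.1] at fin
  refine fin.trans ?_
  have := norm_stopPath_le x t
  gcongr

/-! ### Compactness of the bundle of extensions -/

lemma compact_modulus {n : ℕ} {h T : ℝ} {C : ℝ → ℝ} (hC : Continuous C) (R M : ℝ) :
    ∃ K : Set (PathSp n h T), IsCompact K ∧ ∀ z : PathSp n h T, (∀ τ, ‖z τ‖ ≤ R) →
      (∀ τ₁ τ₂, dist (z τ₁) (z τ₂) ≤ M * |C τ₁.1 - C τ₂.1|) → z ∈ K := by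
  let e := ContinuousMap.isometryEquivBoundedOfCompact (Set.Icc (-h) T) (Euc n)
  let A : Set (BoundedContinuousFunction (Set.Icc (-h) T) (Euc n)) :=
    {f | (∀ τ, ‖f τ‖ ≤ R) ∧ ∀ τ₁ τ₂, dist (f τ₁) (f τ₂) ≤ M * |C τ₁.1 - C τ₂.1|}
  have hA : IsCompact (closure A) := by
    refine BoundedContinuousFunction.arzela_ascoli (Metric.closedBall (0 : Euc n) R)
      (isCompact_closedBall _ _) A ?_ ?_
    · intro f x hf
      simpa using hf.1 x
    · intro x₀
      refine Metric.equicontinuousAt_of_continuity_modulus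
        (fun x => M * |C x₀.1 - C x.1|) ?_ _ ?_
      · have : Continuous (fun x : Set.Icc (-h) T => M * |C x₀.1 - C x.1|) := by fun_prop
        have := this.tendsto x₀
        simpa using this
      · exact Eventually.of_forall fun x i => i.2.2 x₀ x
  refine ⟨e.symm '' closure A, hA.image e.symm.isometry.continuous, ?_⟩
  intro z h1 h2
  refine ⟨e z, subset_closure ⟨?_, ?_⟩, by simp⟩
  · intro τ; exact h1 τ
  · intro τ₁ τ₂; exact h2 τ₁ τ₂

lemma y_bound {n : ℕ} {h T : ℝ} {t : ℝ} {x : PathSp n h T} {c : ℝ → ℝ}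
    (hc0 : ∀ ξ, 0 ≤ c ξ) {M : ℝ} {p : PathSp n h T × (ℝ → Euc n)} (hp : p ∈ YPair t x c)
    (hM : 1 + ‖p.1‖ ≤ M) :
    ∀ᵐ ξ ∂(volume.restrict (Set.Icc t T)), ‖p.2 ξ‖ ≤ M * c ξ := by
  filter_upwards [hp.2] with ξ hξ
  refine hξ.trans ?_
  rw [mul_comm]
  have := norm_stopPath_le p.1 ξ
  exact mul_le_mul_of_nonneg_right (by linarith) (hc0 ξ)

open scoped Pointwise in
lemma compact_Y {n : ℕ} {h T : ℝ} (hh : 0 ≤ h) {c : ℝ → ℝ}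
    (hc : Integrable c) (hc0 : ∀ ξ, 0 ≤ c ξ) {D : Set (PathSp n h T)} (hD : IsCompact D) :
    ∃ K : Set (PathSp n h T), ∃ M : ℝ, IsCompact K ∧ 0 < M ∧ D ⊆ K ∧
      ∀ t ∈ Set.Icc (0:ℝ) T, ∀ x ∈ D, ∀ p ∈ YPair t x c, p.1 ∈ K ∧ 1 + ‖p.1‖ ≤ M := by
  obtain ⟨G, hG, hGb⟩ := gronwall_bound (n := n) (T := T) hh hc hc0
  obtain ⟨B, hB⟩ := hD.isBounded.exists_norm_le
  set M := G * (1 + |B|) with hMdef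
  have hM : 0 < M := by positivity
  have hMb : ∀ t ∈ Set.Icc (0:ℝ) T, ∀ x ∈ D, ∀ p ∈ YPair t x c, 1 + ‖p.1‖ ≤ M := by
    intro t ht x hx p hp
    refine (hGb t ht x p hp).trans ?_
    have := hB x hx
    have := le_abs_self B
    exact mul_le_mul_of_nonneg_left (by linarith) hG.le
  have hC : Continuous (fun τ => ∫ ξ in (0:ℝ)..τ, c ξ) :=
    intervalIntegral.continuous_primitive (fun a b => hc.intervalIntegrable) 0
  obtain ⟨K2, hK2, hz⟩ := compact_modulus (n := n) (h := h) (T := T) hC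
    (M * ∫ ξ in (0:ℝ)..T, c ξ) M
  have hK1 : IsCompact ((fun q : ℝ × PathSp n h T => stopPath q.1 q.2) '' (Set.Icc 0 T ×ˢ D)) :=
    (isCompact_Icc.prod hD).image continuous_stopPath_uncurry
  refine ⟨D ∪ ((fun q : ℝ × PathSp n h T => stopPath q.1 q.2) '' (Set.Icc 0 T ×ˢ D) + K2), M,
    hD.union (hK1.add hK2), hM, subset_union_left, ?_⟩
  intro t ht x hx p hp
  refine ⟨Or.inr ?_, hMb t ht x hx p hp⟩
  refine Set.mem_add.2 ⟨stopPath t x, ⟨(t, x), ⟨ht, hx⟩, rfl⟩, p.1 - stopPath t x, ?_, by abel⟩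
  have hb := y_bound hc0 hp (hMb t ht x hx p hp)
  have hb' : ∀ b, ∀ᵐ ξ ∂(volume.restrict (Set.Icc t T)), ξ ≤ b → ‖p.2 ξ‖ ≤ M * c ξ := by
    intro b; filter_upwards [hb] with ξ hξ _ using hξ
  have rep : ∀ τ : Set.Icc (-h) T, (p.1 - stopPath t x) τ = ∫ ξ in t..(max τ.1 t), p.2 ξ := by
    intro τ
    rw [← evalP_eq (p.1 - stopPath t x) τ.2, evalP_sub, evalP_stopPath x hh ht.1 τ.2]
    rcases le_total τ.1 t with hτ | hτ
    · rw [min_eq_left hτ, max_eq_right hτ, ac_eval_left hh ht hp.1 τ.2.1 hτ]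
      simp
    · rw [min_eq_right hτ, max_eq_left hτ, ac_eval_right hh ht hp.1 hτ τ.2.2]
      simp
  have dif : ∀ τ₁ τ₂ : Set.Icc (-h) T, τ₁.1 ≤ τ₂.1 →
      ‖(p.1 - stopPath t x) τ₂ - (p.1 - stopPath t x) τ₁‖ ≤ M * ∫ ξ in τ₁.1..τ₂.1, c ξ := by
    intro τ₁ τ₂ h12
    have hm := max_le_max_right t h12
    rw [rep, rep, intervalIntegral.integral_interval_sub_left
      (ac_ii hp.1 le_rfl (le_max_right _ _) (max_le τ₂.2.2 ht.2))
      (ac_ii hp.1 le_rfl (le_max_right _ _) (max_le τ₁.2.2 ht.2))]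
    refine (int_le_of_ae (t := t) (T := T) hc (hb' _) (le_max_right _ _) hm
      (max_le τ₂.2.2 ht.2)).trans ?_
    refine mul_le_mul_of_nonneg_left ?_ hM.le
    rcases le_total τ₂.1 t with h2 | h2
    · rw [max_eq_right h2, max_eq_right (h12.trans h2)]
      simpa using int_nonneg hc0 h12
    · rw [max_eq_left h2]
      exact int_mono hc hc0 (le_max_left _ _) (max_le h12 h2) le_rfl
  apply hz
  · intro τ
    rw [rep]
    refine (int_le_of_ae (t := t) (T := T) hc (hb' _) le_rfl (le_max_right _ _)
      (max_le τ.2.2 ht.2)).trans ?_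
    exact mul_le_mul_of_nonneg_left (int_mono hc hc0 ht.1 (le_max_right _ _)
      (max_le τ.2.2 ht.2)) hM.le
  · intro τ₁ τ₂
    rw [intervalIntegral.integral_interval_sub_left hc.intervalIntegrable hc.intervalIntegrable]
    rcases le_total τ₁.1 τ₂.1 with h12 | h12
    · rw [dist_comm, dist_eq_norm]
      refine (dif _ _ h12).trans ?_
      rw [intervalIntegral.integral_symm]
      exact mul_le_mul_of_nonneg_left (neg_le_abs _) hM.le
    · rw [dist_eq_norm]
      refine (dif _ _ h12).trans ?_
      exact mul_le_mul_of_nonneg_left (le_abs_self _) hM.le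

/-! ### Consequences of (A.1)-(A.5) -/

lemma full_ae {T : ℝ} {S : Set ℝ} (hS : S ⊆ Set.Icc 0 T)
    (hvol : volume S = ENNReal.ofReal T) {f g : ℝ → ℝ}
    (hf : AEMeasurable f (volume.restrict (Set.Icc 0 T)))
    (hg : AEMeasurable g (volume.restrict (Set.Icc 0 T)))
    (H : ∀ t ∈ S, f t ≤ g t) : ∀ᵐ t ∂(volume.restrict (Set.Icc 0 T)), f t ≤ g t := by
  rw [ae_iff_measure_eq (nullMeasurableSet_le hf hg)]
  apply le_antisymm (measure_mono (subset_univ _))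
  calc (volume.restrict (Set.Icc 0 T)) univ = ENNReal.ofReal T := by simp
    _ = (volume.restrict (Set.Icc 0 T)) S := by
        rw [Measure.restrict_apply' measurableSet_Icc, inter_eq_left.2 hS, hvol]
    _ ≤ _ := measure_mono (fun t ht => H t ht)

lemma H_aem {n : ℕ} {h T : ℝ} {H : ℝ → PathSp n h T → Euc n → ℝ} (h1 : CondA1 H)
    (x : PathSp n h T) (s : Euc n) :
    AEMeasurable (fun t => H t x s) (volume.restrict (Set.Icc 0 T)) :=
  aemeasurable_restrict_of_measurable_subtype measurableSet_Icc (h1 x s)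

lemma continuous_stop_t {n : ℕ} {h T : ℝ} (x : PathSp n h T) :
    Continuous (fun t => stopPath t x) :=
  continuous_stopPath_uncurry.comp (by fun_prop : Continuous (fun t : ℝ => (t, x)))

lemma ind_ae {T : ℝ} (f : ℝ → ℝ) :
    (Set.Icc 0 T).indicator f =ᵐ[volume.restrict (Set.Icc 0 T)] f :=
  indicator_ae_eq_restrict measurableSet_Icc

lemma ind_integ {T : ℝ} {f : ℝ → ℝ} (hf : IntegNonneg T f) :
    Integrable ((Set.Icc 0 T).indicator f) ∧ ∀ ξ, 0 ≤ (Set.Icc 0 T).indicator f ξ :=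
  ⟨hf.1.integrable_indicator measurableSet_Icc, fun _ => indicator_nonneg hf.2 _⟩

lemma a3_ae {n : ℕ} {h T : ℝ} {H : ℝ → PathSp n h T → Euc n → ℝ} (h1 : CondA1 H)
    (h3 : CondA3 H) {K : Set (PathSp n h T)} (hK : IsCompact K) :
    ∃ lam : ℝ → ℝ, Integrable lam ∧ (∀ ξ, 0 ≤ lam ξ) ∧ ∀ x₁ ∈ K, ∀ x₂ ∈ K, ∀ s : Euc n,
      ∀ᵐ t ∂(volume.restrict (Set.Icc 0 T)), |H t x₁ s - H t x₂ s| ≤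
        lam t * ((1 + ‖s‖) * ‖stopPath t x₁ - stopPath t x₂‖) := by
  obtain ⟨lam, hl, H3⟩ := h3 K hK
  refine ⟨(Set.Icc 0 T).indicator lam, (ind_integ hl).1, (ind_integ hl).2, ?_⟩
  intro x₁ hx₁ x₂ hx₂ s
  obtain ⟨E, hE, hv, hEE⟩ := H3 x₁ hx₁ x₂ hx₂ s
  have := full_ae hE hv (f := fun t => |H t x₁ s - H t x₂ s|)
    (g := fun t => lam t * (1 + ‖s‖) * ‖stopPath t x₁ - stopPath t x₂‖)
    (by
      have := ((H_aem h1 x₁ s).sub (H_aem h1 x₂ s)).norm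
      exact this)
    (by
      refine (hl.1.aemeasurable.mul_const _).mul ?_
      exact ((continuous_stop_t x₁).sub (continuous_stop_t x₂)).norm.aemeasurable) hEE
  filter_upwards [this, ind_ae lam] with t ht h2
  rw [h2, ← mul_assoc]
  exact ht

lemma a4_ae {n : ℕ} {h T : ℝ} {H : ℝ → PathSp n h T → Euc n → ℝ} {cH : ℝ → ℝ} (h1 : CondA1 H)
    (h4 : CondA4 H cH) (x : PathSp n h T) (s₁ s₂ : Euc n) :
      ∀ᵐ t ∂(volume.restrict (Set.Icc 0 T)), |H t x s₁ - H t x s₂| ≤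
        (Set.Icc 0 T).indicator cH t * ((1 + ‖x‖) * ‖s₁ - s₂‖) := by
  obtain ⟨hc, E, hE, hv, hEE⟩ := h4
  have := full_ae hE hv (f := fun t => |H t x s₁ - H t x s₂|)
    (g := fun t => cH t * (1 + ‖stopPath t x‖) * ‖s₁ - s₂‖)
    (by
      have := ((H_aem h1 x s₁).sub (H_aem h1 x s₂)).norm
      exact this)
    (by
      refine (hc.1.aemeasurable.mul ?_).mul_const _
      exact (continuous_const.add (continuous_stop_t x).norm).aemeasurable)
    (fun t ht => hEE t ht x s₁ s₂)
  filter_upwards [this, ind_ae cH, ae_restrict_mem measurableSet_Icc] with t ht h2 hm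
  rw [h2, ← mul_assoc]
  refine ht.trans ?_
  have := norm_stopPath_le x t
  have := hc.2 t hm
  gcongr

lemma H_integ {n : ℕ} {h T : ℝ} {H : ℝ → PathSp n h T → Euc n → ℝ} {cH : ℝ → ℝ}
    (hH : CondA H cH) (x : PathSp n h T) (s : Euc n) :
    IntegrableOn (fun t => H t x s) (Set.Icc 0 T) := by
  obtain ⟨h1, h2, h3, h4, h5⟩ := hH
  obtain ⟨m, hm, H5⟩ := h5 {x} isCompact_singleton
  obtain ⟨E, hE, hv, hEE⟩ := H5 x rfl
  have e5 := full_ae hE hv (f := fun t => |H t x 0|) (g := m) 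
    (H_aem h1 x 0).norm hm.1.aemeasurable hEE
  have e4 := a4_ae h1 h4 x s 0
  have ic := (ind_integ h4.1).1.integrableOn (s := Set.Icc 0 T)
  refine Integrable.mono' (hm.1.add (ic.mul_const ((1 + ‖x‖) * ‖s - 0‖)))
    (H_aem h1 x s).aestronglyMeasurable ?_
  filter_upwards [e5, e4] with t h5 h4
  have := abs_sub_abs_le_abs_sub (H t x s) (H t x 0)
  simp only [Real.norm_eq_abs, Pi.add_apply]
  linarith

/-! ### Splicing -/

lemma make_ac {n : ℕ} {h T : ℝ} (hh : 0 ≤ h) {t : ℝ} (ht : t ∈ Set.Icc 0 T)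
    (x : PathSp n h T) {f : ℝ → Euc n} (hf : Integrable f) :
    ∃ y : PathSp n h T, (y, f) ∈ ACPair t x := by
  have hC : Continuous (fun τ => ∫ ξ in t..τ, f ξ) :=
    intervalIntegral.continuous_primitive (fun a b => hf.intervalIntegrable) t
  let y : PathSp n h T := ⟨fun τ => stopPath t x τ + ∫ ξ in t..(max τ.1 t), f ξ, by
    refine (stopPath t x).continuous.add ?_
    exact hC.comp (by fun_prop : Continuous (fun τ : Set.Icc (-h) T => max τ.1 t))⟩
  have hy : ∀ τ ∈ Set.Icc (-h) T, evalP y τ = evalP x (min τ t) + ∫ ξ in t..(max τ t), f ξ := by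
    intro τ hτ
    rw [← evalP_stopPath x hh ht.1 hτ, evalP_eq _ hτ, evalP_eq _ hτ]
    rfl
  refine ⟨y, ?_, hf.intervalIntegrable, ?_⟩
  · ext1 τ
    rw [← evalP_eq _ τ.2, ← evalP_eq _ τ.2, evalP_stopPath _ hh ht.1 τ.2,
      evalP_stopPath _ hh ht.1 τ.2, hy]
    · simp
    · exact ⟨le_min τ.2.1 (by linarith [ht.1]), (min_le_left _ _).trans τ.2.2⟩
  · intro τ hτ
    rw [hy τ ⟨by linarith [ht.1, hτ.1], hτ.2⟩, hy t ⟨by linarith [ht.1], ht.2⟩]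
    simp [hτ.1]

lemma splice {n : ℕ} {h T : ℝ} (hh : 0 ≤ h) {t : ℝ} (ht : t ∈ Set.Ico 0 T)
    {x : PathSp n h T} {c : ℝ → ℝ} (hc : Integrable c) (hc0 : ∀ ξ, 0 ≤ c ξ) {M : ℝ} (hM : 0 < M)
    {u : ℕ → ℝ} {p : ℕ → PathSp n h T × (ℝ → Euc n)} (hu : ∀ k, u k ∈ Set.Ioo t T)
    (hanti : Antitone u) (hlim : Tendsto u atTop (𝓝 t))
    (hp : ∀ k, p k ∈ ACPair t x)
    (hb : ∀ k, ∀ᵐ ξ ∂(volume.restrict (Set.Icc t T)), ‖(p k).2 ξ‖ ≤ M * c ξ) :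
    ∃ q ∈ ACPair t x, (∀ᵐ ξ ∂(volume.restrict (Set.Icc t T)), ‖q.2 ξ‖ ≤ M * c ξ) ∧
      ∀ k, ‖stopPath (u k) q.1 - stopPath (u k) (p k).1‖ ≤
        2 * M * ∫ ξ in t..(u (k+1)), c ξ := by
  have ht' : t ∈ Set.Icc 0 T := ⟨ht.1, ht.2.le⟩
  let N : ℝ → ℕ := fun ξ => sInf {k | u (k+1) < ξ}
  let v : ℕ → ℝ := fun k => if k = 0 then T else u k
  have hN1 : ∀ ξ ∈ Set.Ioc t T, ξ ∈ Set.Ioc (u (N ξ + 1)) (v (N ξ)) := by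
    intro ξ hξ
    have hne : {k | u (k+1) < ξ}.Nonempty := by
      have := (hlim.comp (tendsto_add_atTop_nat 1)).eventually (gt_mem_nhds hξ.1)
      obtain ⟨k, hk⟩ := this.exists
      exact ⟨k, hk⟩
    refine ⟨Nat.sInf_mem hne, ?_⟩
    by_cases h0 : N ξ = 0
    · simp only [v, h0, if_true]; exact hξ.2
    · simp only [v, h0, if_false]
      have : N ξ - 1 ∉ {k | u (k+1) < ξ} := Nat.notMem_of_lt_sInf (by
        change N ξ - 1 < N ξ; omega)
      simp only [mem_ofPred_eq, not_lt] at this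
      rwa [Nat.sub_add_cancel (by omega)] at this
  have hN2 : ∀ k, ∀ ξ ∈ Set.Ioc (u (k+1)) (v k), N ξ = k := by
    intro k ξ hξ
    have hle : N ξ ≤ k := Nat.sInf_le hξ.1
    have hmem : u (N ξ + 1) < ξ := Nat.sInf_mem (s := {k | u (k+1) < ξ}) ⟨k, hξ.1⟩
    rcases hle.lt_or_eq with hlt | heq
    · exfalso
      have h1 : ξ ≤ u k := by
        have := hξ.2
        simpa only [v, if_neg (by omega : k ≠ 0)] using this
      have := hanti (by omega : N ξ + 1 ≤ k)
      linarith
    · exact heq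
  have huv : ∀ k, u k ≤ v k := by
    intro k
    simp only [v]
    split_ifs
    · exact (hu k).2.le
    · exact le_rfl
  have hvT : ∀ k, v k ≤ T := by
    intro k
    simp only [v]
    split_ifs
    · exact le_rfl
    · exact (hu k).2.le
  let f0 : ℝ → Euc n := fun ξ => (p (N ξ)).2 ξ
  let f : ℝ → Euc n := (Set.Ioc t T).indicator f0
  have hb' : ∀ᵐ ξ, ξ ∈ Set.Icc t T → ∀ k, ‖(p k).2 ξ‖ ≤ M * c ξ := by
    have := ae_all_iff.2 hb
    exact (ae_restrict_iff' measurableSet_Icc).1 this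
  have hfb : ∀ᵐ ξ, ‖f ξ‖ ≤ M * c ξ := by
    filter_upwards [hb'] with ξ hξ
    by_cases hm : ξ ∈ Set.Ioc t T
    · simp only [f, indicator_of_mem hm]
      exact hξ ⟨hm.1.le, hm.2⟩ _
    · simp only [f, indicator_of_notMem hm, norm_zero]
      exact mul_nonneg hM.le (hc0 ξ)
  have hmeas : AEStronglyMeasurable f0 (volume.restrict (Set.Ioc t T)) := by
    have hsub : Set.Ioc t T ⊆ ⋃ k, Set.Ioc (u (k+1)) (v k) := fun ξ hξ =>
      mem_iUnion.2 ⟨N ξ, hN1 ξ hξ⟩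
    refine AEStronglyMeasurable.mono_set hsub ?_
    rw [aestronglyMeasurable_iUnion_iff]
    intro k
    have h1 : AEStronglyMeasurable (p k).2 (volume.restrict (Set.Ioc (u (k+1)) (v k))) := by
      have := ((intervalIntegrable_iff_integrableOn_Ioc_of_le ht.2.le).1
        (hp k).2.1).aestronglyMeasurable
      exact this.mono_set (Ioc_subset_Ioc (hu (k+1)).1.le (hvT k))
    refine h1.congr ?_
    filter_upwards [ae_restrict_mem measurableSet_Ioc] with ξ hξ
    simp only [f0, hN2 k ξ hξ]
  have hfi : Integrable f := by
    refine Integrable.mono' (hc.const_mul M) ?_ hfb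
    exact (aestronglyMeasurable_indicator_iff measurableSet_Ioc).2 hmeas
  obtain ⟨y, hy⟩ := make_ac hh ht' x hfi
  refine ⟨(y, f), hy, ae_restrict_of_ae hfb, ?_⟩
  intro k
  have hI := int_nonneg hc0 (hu (k+1)).1.le
  rw [← stopPath_sub]
  refine norm_stop_le_of_evalP hh _ (ht.1.trans (hu k).1.le) (by positivity) ?_
  intro τ h1 h2
  rw [evalP_sub]
  rcases le_total τ t with hτ | hτ
  · have e1 := ac_eval_left hh ht' hy h1 hτ
    have e2 := ac_eval_left hh ht' (hp k) h1 hτ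
    simp only at e1
    rw [e1, e2, sub_self, norm_zero]
    positivity
  · have hτT : τ ≤ T := h2.trans (hu k).2.le
    have e1 := ac_eval_right hh ht' hy hτ hτT
    have e2 := ac_eval_right hh ht' (hp k) hτ hτT
    simp only at e1
    rw [e1, e2, add_sub_add_left_eq_sub]
    set r := min τ (u (k+1)) with hr
    have hr1 : t ≤ r := le_min hτ (hu (k+1)).1.le
    have hr2 : r ≤ τ := min_le_left _ _
    have hii1 : ∀ a b, IntervalIntegrable f volume a b := fun a b => hfi.intervalIntegrable
    have hii2 := ac_ii (hp k) le_rfl hr1 (hr2.trans hτT)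
    have hii3 := ac_ii (hp k) hr1 hr2 hτT
    rw [← intervalIntegral.integral_add_adjacent_intervals (hii1 t r) (hii1 r τ),
      ← intervalIntegral.integral_add_adjacent_intervals hii2 hii3]
    have heq : ∫ ξ in r..τ, f ξ = ∫ ξ in r..τ, (p k).2 ξ := by
      refine intervalIntegral.integral_congr_ae ?_
      refine Eventually.of_forall fun ξ hξ => ?_
      rw [uIoc_of_le hr2] at hξ
      have hu1 : u (k+1) < ξ := by
        by_contra hcon
        push Not at hcon
        have : ξ ≤ r := le_min hξ.2 hcon
        linarith [hξ.1]
      have hm : ξ ∈ Set.Ioc t T := ⟨(hu (k+1)).1.trans hu1, hξ.2.trans hτT⟩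
      simp only [f, indicator_of_mem hm, f0]
      rw [hN2 k ξ ⟨hu1, (hξ.2.trans h2).trans (huv k)⟩]
    rw [heq, add_sub_add_right_eq_sub]
    refine (norm_sub_le _ _).trans ?_
    have b1 := int_le_of_ae (t := t) (T := T) (a := t) (b := r) (q := f) (M := M) hc
      (ae_restrict_of_ae (by filter_upwards [hfb] with ξ hξ _ using hξ)) le_rfl hr1
      (hr2.trans hτT)
    have b2 := int_le_of_ae (t := t) (T := T) (a := t) (b := r) (q := (p k).2) (M := M) hc
      (by filter_upwards [hb k] with ξ hξ _ using hξ) le_rfl hr1 (hr2.trans hτT)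
    have b3 := mul_le_mul_of_nonneg_left
      (int_mono hc hc0 (le_refl t) hr1 (min_le_right τ (u (k+1)))) hM.le
    linarith

lemma core {n : ℕ} {h T : ℝ} (hh : 0 ≤ h) {φ : ℝ → PathSp n h T → ℝ}
    {t : ℝ} (ht : t ∈ Set.Ico 0 T)
    {x : PathSp n h T} {c : ℝ → ℝ} (hc : Integrable c) (hc0 : ∀ ξ, 0 ≤ c ξ) {M : ℝ} (hM : 0 < M)
    {B : ℝ} (hB : 0 ≤ B) (hcB : ∀ᶠ τ in 𝓝[>] t, ∫ ξ in t..τ, c ξ ≤ B * (τ - t))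
    (hna : NonAnticipative φ) (husc : ∀ τ ∈ Set.Icc 0 T, UpperSemicontinuous (φ τ))
    {a : ℝ} {g : Euc n} (hd : HasCiDeriv φ t x a g) {b : ℝ}
    (hex : ∀ᶠ τ in 𝓝[>] t, ∃ p ∈ ACPair t x,
      (∀ᵐ ξ ∂(volume.restrict (Set.Icc t T)), ‖p.2 ξ‖ ≤ M * c ξ) ∧
      φ τ p.1 - φ t x - @inner ℝ _ _ g (evalP p.1 τ - evalP x t) ≤ b * (τ - t)) :
    a ≤ b := by
  by_contra hlt
  push Not at hlt
  set ε := (a - b) / 2 with hε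
  have hεp : 0 < ε := by rw [hε]; linarith
  -- good paths with stability radius
  obtain ⟨δ, hδ, hex⟩ := (mem_nhdsGT_iff_exists_Ioo_subset' ht.2).1
    (hex.and (Ioo_mem_nhdsGT ht.2))
  have good : ∀ τ : Set.Ioo t δ, ∃ p ∈ ACPair t x, ∃ d > 0,
      (∀ᵐ ξ ∂(volume.restrict (Set.Icc t T)), ‖p.2 ξ‖ ≤ M * c ξ) ∧
      ∀ z : PathSp n h T, ‖stopPath τ.1 z - stopPath τ.1 p.1‖ < d →
        φ τ z - φ t x - @inner ℝ _ _ g (evalP z τ - evalP x t) ≤ (b + ε) * (τ - t) := by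
    intro τ
    obtain ⟨⟨p, hp, hpb, hpφ⟩, hτ⟩ := hex τ.2
    have hτ' : τ.1 ∈ Set.Icc 0 T := ⟨ht.1.trans hτ.1.le, hτ.2.le⟩
    have hτm : τ.1 ∈ Set.Icc (-h) T := ⟨by linarith [hτ'.1], hτ'.2⟩
    have hev : ∀ z : PathSp n h T, evalP (stopPath τ.1 z) τ.1 = evalP z τ.1 := by
      intro z
      rw [evalP_stopPath z hh hτ'.1 hτm, min_self]
    have hcont : Continuous (fun z : PathSp n h T =>
        - φ t x - @inner ℝ _ _ g (evalP z τ.1 - evalP x t)) := by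
      have : Continuous (fun z : PathSp n h T => evalP z τ.1) := by
        have e : (fun z : PathSp n h T => evalP z τ.1) = fun z => z ⟨τ.1, hτm⟩ := by
          ext1 z; exact evalP_eq z hτm
        rw [e]; fun_prop
      fun_prop
    have hu := (husc τ.1 hτ').add hcont.upperSemicontinuous
    have hw : φ τ.1 (stopPath τ.1 p.1) +
        (- φ t x - @inner ℝ _ _ g (evalP (stopPath τ.1 p.1) τ.1 - evalP x t)) <
        (b + ε) * (τ.1 - t) := by
      rw [hev, ← hna _ hτ']
      have : 0 < ε * (τ.1 - t) := mul_pos hεp (by linarith [hτ.1])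
      linarith
    obtain ⟨d, hd0, hball⟩ := Metric.mem_nhds_iff.1 (hu (stopPath τ.1 p.1) _ hw)
    refine ⟨p, hp, d, hd0, hpb, fun z hz => ?_⟩
    have h1 : stopPath τ.1 z ∈ Metric.ball (stopPath τ.1 p.1) d := by
      rw [Metric.mem_ball, dist_eq_norm]; exact hz
    have h2 := hball h1
    simp only [mem_ofPred_eq] at h2
    rw [hev, ← hna _ hτ'] at h2
    linarith
  choose P hP d hd0 hPb hPd using good
  have hCt : Tendsto (fun τ => ∫ ξ in t..τ, c ξ) (𝓝[>] t) (𝓝 0) := by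
    have hC : Continuous (fun τ => ∫ ξ in t..τ, c ξ) :=
      intervalIntegral.continuous_primitive (fun a b => hc.intervalIntegrable) t
    have := (hC.tendsto t).mono_left (nhdsWithin_le_nhds (s := Set.Ioi t))
    simpa using this
  have next : ∀ τ : Set.Ioo t δ, ∃ τ' : Set.Ioo t δ, τ'.1 - t ≤ (τ.1 - t) / 2 ∧
      2 * M * ∫ ξ in t..τ'.1, c ξ < d τ := by
    intro τ
    have h1 : ∀ᶠ τ' in 𝓝[>] t, 2 * M * ∫ ξ in t..τ', c ξ < d τ := by
      have := hCt.const_mul (2 * M)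
      rw [mul_zero] at this
      exact this.eventually (gt_mem_nhds (hd0 τ))
    have h2 : ∀ᶠ τ' in 𝓝[>] t, τ' ∈ Set.Ioo t (t + (τ.1 - t)/2) :=
      Ioo_mem_nhdsGT (by linarith [τ.2.1])
    obtain ⟨τ', h1, h2⟩ := (h1.and h2).exists
    exact ⟨⟨τ', h2.1, by linarith [h2.2, τ.2.1, τ.2.2]⟩, by linarith [h2.2], h1⟩
  choose nx hn1 hn2 using next
  have hδt : t < δ := hδ
  let u0 : Set.Ioo t δ := ⟨(t + δ)/2, by linarith, by linarith⟩
  let U : ℕ → Set.Ioo t δ := fun k => nx^[k] u0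
  have hU : ∀ k, U (k+1) = nx (U k) := fun k => Function.iterate_succ_apply' nx k u0
  have hhalf : ∀ k, (U (k+1)).1 - t ≤ ((U k).1 - t)/2 := by
    intro k; rw [hU]; exact hn1 _
  have hanti : Antitone (fun k => (U k).1) := antitone_nat_of_succ_le fun k => by
    have := hhalf k
    have := (U k).2.1
    linarith
  have hgeo : ∀ k, (U k).1 - t ≤ (1/2)^k * ((U 0).1 - t) := by
    intro k
    induction k with
    | zero => simp
    | succ k ih => 
      have := hhalf k
      rw [pow_succ]
      linarith
  have hlim : Tendsto (fun k => (U k).1) atTop (𝓝 t) := by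
    have h1 : Tendsto (fun k : ℕ => t + (1/2:ℝ)^k * ((U 0).1 - t)) atTop (𝓝 t) := by
      have := ((tendsto_pow_atTop_nhds_zero_of_lt_one (r := (1/2:ℝ)) (by norm_num)
        (by norm_num)).mul_const ((U 0).1 - t)).const_add t
      simpa using this
    refine tendsto_of_tendsto_of_tendsto_of_le_of_le tendsto_const_nhds h1 ?_ ?_
    · intro k; exact (U k).2.1.le
    · intro k; simp only; linarith [hgeo k]
  have hUT : ∀ k, (U k).1 ∈ Set.Ioo t T := fun k => (hex (U k).2).2
  obtain ⟨q, hq, hqb, hqs⟩ := splice hh ht hc hc0 hM hUT hanti hlim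
    (p := fun k => P (U k)) (fun k => hP _) (fun k => hPb _)
  have hqΨ : ∀ k, φ (U k).1 q.1 - φ t x - @inner ℝ _ _ g (evalP q.1 (U k).1 - evalP x t) ≤
      (b + ε) * ((U k).1 - t) := by
    intro k
    refine hPd (U k) q.1 ((hqs k).trans_lt ?_)
    rw [hU]; exact hn2 _
  obtain ⟨o, ho, hlim0⟩ := hd q hq
  have hpos : 0 < 1 + M * B := by positivity
  have hev1 := hlim0.eventually (lt_mem_nhds (show -(ε / (1 + M * B)) < 0 by
    have : 0 < ε / (1 + M * B) := by positivity
    linarith))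
  have hUw : Tendsto (fun k => (U k).1) atTop (𝓝[>] t) :=
    tendsto_nhdsWithin_iff.2 ⟨hlim, Eventually.of_forall fun k => (U k).2.1⟩
  obtain ⟨k, hk1, hk2⟩ := ((hUw.eventually hev1).and (hUw.eventually hcB)).exists
  set τ := (U k).1 with hτ
  have hτT := hUT k
  have e1 := ho τ ⟨hτT.1, hτT.2.le⟩
  have e2 := hqΨ k
  have hτp : 0 < τ - t := by linarith [hτT.1]
  have e3 : ∫ ξ in t..τ, ‖q.2 ξ‖ ≤ M * (B * (τ - t)) := by
    have h2 : ∫ ξ in t..τ, ‖q.2 ξ‖ ≤ ∫ ξ in t..τ, M * c ξ := by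
      refine intervalIntegral.integral_mono_ae_restrict hτT.1.le
        (ac_ii hq le_rfl hτT.1.le hτT.2.le).norm (hc.const_mul M).intervalIntegrable ?_
      exact ae_restrict_of_ae_restrict_of_subset (Icc_subset_Icc le_rfl hτT.2.le) hqb
    rw [intervalIntegral.integral_const_mul] at h2
    exact h2.trans (mul_le_mul_of_nonneg_left hk2 hM.le)
  have e4 : 0 ≤ ∫ ξ in t..τ, ‖q.2 ξ‖ :=
    intervalIntegral.integral_nonneg hτT.1.le fun ξ _ => norm_nonneg _
  rw [lt_div_iff₀ (by linarith)] at hk1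
  have e5 : ε / (1 + M * B) * (τ - t + ∫ ξ in t..τ, ‖q.2 ξ‖) ≤ ε * (τ - t) := by
    calc ε / (1 + M * B) * (τ - t + ∫ ξ in t..τ, ‖q.2 ξ‖)
        ≤ ε / (1 + M * B) * ((1 + M * B) * (τ - t)) := by
          refine mul_le_mul_of_nonneg_left (by linarith) (by positivity)
      _ = ε * (τ - t) := by field_simp
  have e6 : a - (b + ε) = ε := by rw [hε]; ring
  nlinarith

/-! ### Lebesgue points and the estimate of the Hamiltonian integral -/

/-- The right averages of `f` at `t` converge to `f t`. -/
def RightLeb (f : ℝ → ℝ) (t : ℝ) : Prop :=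
  Tendsto (fun τ => (∫ ξ in t..τ, f ξ) / (τ - t)) (𝓝[>] t) (𝓝 (f t))

lemma ae_rightLeb {T : ℝ} (hT : 0 < T) {f : ℝ → ℝ} (hf : IntegrableOn f (Set.Icc 0 T)) :
    ∀ᵐ t, t ∈ Set.Icc 0 T → RightLeb f t := by
  have h1 : IntervalIntegrable f volume 0 T :=
    (intervalIntegrable_iff_integrableOn_Icc_of_le hT.le).2 hf
  filter_upwards [h1.ae_hasDerivAt_integral] with t ht hm
  rw [uIcc_of_le hT.le] at ht
  have := (ht hm t hm).tendsto_slope.mono_left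
    (nhdsWithin_mono t (fun τ (hτ : t < τ) => (ne_of_gt hτ : τ ≠ t)))
  refine this.congr fun τ => ?_
  simp [slope_def_field]

lemma RightLeb.est {f : ℝ → ℝ} {t : ℝ} (hf : RightLeb f t) {ε : ℝ} (hε : 0 < ε) :
    ∀ᶠ τ in 𝓝[>] t, |(∫ ξ in t..τ, f ξ) - f t * (τ - t)| ≤ ε * (τ - t) := by
  have h1 := (Metric.tendsto_nhds.1 hf) ε hε
  filter_upwards [h1, self_mem_nhdsWithin] with τ h1 (h2 : t < τ)
  have hp : 0 < τ - t := by linarith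
  rw [Real.dist_eq] at h1
  have e : (∫ ξ in t..τ, f ξ) - f t * (τ - t) =
      ((∫ ξ in t..τ, f ξ) / (τ - t) - f t) * (τ - t) := by field_simp
  rw [e, abs_mul, abs_of_pos hp]
  exact mul_le_mul_of_nonneg_right h1.le hp.le

lemma RightLeb.bd {f : ℝ → ℝ} {t : ℝ} (hf : RightLeb f t) :
    ∀ᶠ τ in 𝓝[>] t, (∫ ξ in t..τ, f ξ) ≤ (f t + 1) * (τ - t) := by
  filter_upwards [hf.est one_pos] with τ h1
  have := (abs_le.1 h1).2
  linarith

lemma int_diff_le {T : ℝ} {F G B : ℝ → ℝ} (hF : IntegrableOn F (Set.Icc 0 T))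
    (hG : IntegrableOn G (Set.Icc 0 T)) {t τ : ℝ} (h0 : 0 ≤ t) (h1 : t ≤ τ) (h2 : τ ≤ T)
    (hB : Integrable B)
    (hae : ∀ᵐ ξ ∂(volume.restrict (Set.Icc 0 T)), t ≤ ξ → ξ ≤ τ → |F ξ - G ξ| ≤ B ξ) :
    |(∫ ξ in t..τ, F ξ) - ∫ ξ in t..τ, G ξ| ≤ ∫ ξ in t..τ, B ξ := by
  have hs : Set.Icc t τ ⊆ Set.Icc 0 T := Icc_subset_Icc h0 h2
  rw [← intervalIntegral.integral_sub
    ((intervalIntegrable_iff_integrableOn_Icc_of_le h1).2 (hF.mono_set hs))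
    ((intervalIntegrable_iff_integrableOn_Icc_of_le h1).2 (hG.mono_set hs))]
  rw [← Real.norm_eq_abs]
  refine intervalIntegral.norm_integral_le_of_norm_le h1 ?_ hB.intervalIntegrable
  filter_upwards [(ae_restrict_iff' measurableSet_Icc).1 hae] with ξ hξ hm
  exact hξ (hs ⟨hm.1.le, hm.2⟩) hm.1.le hm.2

lemma rightLeb_H {n : ℕ} {h T : ℝ} {H : ℝ → PathSp n h T → Euc n → ℝ}
    (hHi : ∀ x s, IntegrableOn (fun t => H t x s) (Set.Icc 0 T))
    {c lam : ℝ → ℝ} (hc : Integrable c) (hc0 : ∀ ξ, 0 ≤ c ξ)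
    (hl : Integrable lam) (hl0 : ∀ ξ, 0 ≤ lam ξ) {D K : Set (PathSp n h T)} (hDK : D ⊆ K)
    (h3 : ∀ x₁ ∈ K, ∀ x₂ ∈ K, ∀ s : Euc n,
      ∀ᵐ t ∂(volume.restrict (Set.Icc 0 T)), |H t x₁ s - H t x₂ s| ≤
        lam t * ((1 + ‖s‖) * ‖stopPath t x₁ - stopPath t x₂‖))
    (h4 : ∀ (x : PathSp n h T) (s₁ s₂ : Euc n),
      ∀ᵐ t ∂(volume.restrict (Set.Icc 0 T)), |H t x s₁ - H t x s₂| ≤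
        c t * ((1 + ‖x‖) * ‖s₁ - s₂‖))
    {Q : Set (PathSp n h T)} (hQD : Q ⊆ D) (hQ : D ⊆ closure Q) {Q' : Set (Euc n)}
    (hQ' : Dense Q') {t : ℝ} (ht : t ∈ Set.Ico 0 T)
    (hcont : Continuous (fun p : PathSp n h T × Euc n => H t p.1 p.2))
    (hrc : RightLeb c t) (hrl : RightLeb lam t)
    (hrH : ∀ x ∈ Q, ∀ s ∈ Q', RightLeb (fun ξ => H ξ x s) t)
    {x : PathSp n h T} (hx : x ∈ D) (g : Euc n) {ε : ℝ} (hε : 0 < ε) :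
    ∀ᶠ τ in 𝓝[>] t, |(∫ ξ in t..τ, H ξ x g) - H t x g * (τ - t)| ≤ ε * (τ - t) := by
  have hcl : (x, g) ∈ closure (Q ×ˢ Q') := by
    rw [closure_prod_eq]
    exact ⟨hQ hx, hQ' g⟩
  let F : PathSp n h T × Euc n → ℝ := fun q =>
    (lam t + 1) * ((1 + ‖g‖) * ‖x - q.1‖) + (c t + 1) * ((1 + ‖q.1‖) * ‖g - q.2‖) +
      |H t q.1 q.2 - H t x g|
  have hF : Continuous F := by
    have : Continuous (fun q : PathSp n h T × Euc n => |H t q.1 q.2 - H t x g|) :=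
      (hcont.sub continuous_const).abs
    fun_prop
  have hFo : IsOpen {q | F q < ε / 2} := isOpen_lt hF continuous_const
  have hF0 : (x, g) ∈ {q | F q < ε / 2} := by
    simp only [F, mem_ofPred_eq, sub_self, norm_zero, abs_zero, mul_zero, add_zero]
    linarith
  obtain ⟨⟨x0, s0⟩, hq1, hx0, hs0⟩ := mem_closure_iff.1 hcl _ hFo hF0
  simp only [F, mem_ofPred_eq] at hq1 hx0 hs0
  filter_upwards [hrc.bd, hrl.bd, (hrH x0 hx0 s0 hs0).est (half_pos hε), Ioo_mem_nhdsGT ht.2]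
    with τ e1 e2 e3 hτ
  have hp : 0 < τ - t := by linarith [hτ.1]
  have key := int_diff_le (hHi x g) (hHi x0 s0) ht.1 hτ.1.le hτ.2.le
    (B := fun ξ => lam ξ * ((1 + ‖g‖) * ‖x - x0‖) + c ξ * ((1 + ‖x0‖) * ‖g - s0‖))
    ((hl.mul_const _).add (hc.mul_const _)) (by
      filter_upwards [h3 x (hDK hx) x0 (hDK (hQD hx0)) g, h4 x0 g s0] with ξ k3 k4 _ _
      have a1 : ‖stopPath ξ x - stopPath ξ x0‖ ≤ ‖x - x0‖ := by
        rw [← stopPath_sub]; exact norm_stopPath_le _ _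
      have a2 : lam ξ * ((1 + ‖g‖) * ‖stopPath ξ x - stopPath ξ x0‖) ≤
          lam ξ * ((1 + ‖g‖) * ‖x - x0‖) := by
        have := hl0 ξ
        gcongr
      have a3 := abs_sub_le (H ξ x g) (H ξ x0 g) (H ξ x0 s0)
      linarith)
  rw [intervalIntegral.integral_add (hl.mul_const _).intervalIntegrable
    (hc.mul_const _).intervalIntegrable, intervalIntegral.integral_mul_const,
    intervalIntegral.integral_mul_const] at key
  have b1 := mul_le_mul_of_nonneg_right e2 (show 0 ≤ (1 + ‖g‖) * ‖x - x0‖ by positivity)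
  have b2 := mul_le_mul_of_nonneg_right e1 (show 0 ≤ (1 + ‖x0‖) * ‖g - s0‖ by positivity)
  have b3 := mul_lt_mul_of_pos_right hq1 hp
  have b4 : |H t x0 s0 * (τ - t) - H t x g * (τ - t)| = |H t x0 s0 - H t x g| * (τ - t) := by
    rw [← sub_mul, abs_mul, abs_of_pos hp]
  have b5 := abs_sub_le (∫ ξ in t..τ, H ξ x g) (∫ ξ in t..τ, H ξ x0 s0) (H t x g * (τ - t))
  have b6 := abs_sub_le (∫ ξ in t..τ, H ξ x0 s0) (H t x0 s0 * (τ - t)) (H t x g * (τ - t))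
  linarith

lemma est_H {n : ℕ} {h T : ℝ} (hh : 0 ≤ h) {H : ℝ → PathSp n h T → Euc n → ℝ}
    (hHi : ∀ x s, IntegrableOn (fun t => H t x s) (Set.Icc 0 T))
    {c lam : ℝ → ℝ} (hc : Integrable c) (hc0 : ∀ ξ, 0 ≤ c ξ)
    (hl : Integrable lam) (hl0 : ∀ ξ, 0 ≤ lam ξ) {D K : Set (PathSp n h T)} (hDK : D ⊆ K)
    {M : ℝ} (hM : 0 < M)
    (hY : ∀ t ∈ Set.Icc (0:ℝ) T, ∀ x ∈ D, ∀ p ∈ YPair t x c, p.1 ∈ K ∧ 1 + ‖p.1‖ ≤ M)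
    (h3 : ∀ x₁ ∈ K, ∀ x₂ ∈ K, ∀ s : Euc n,
      ∀ᵐ t ∂(volume.restrict (Set.Icc 0 T)), |H t x₁ s - H t x₂ s| ≤
        lam t * ((1 + ‖s‖) * ‖stopPath t x₁ - stopPath t x₂‖))
    {t : ℝ} (ht : t ∈ Set.Ico 0 T) (hrc : RightLeb c t) (hrl : RightLeb lam t)
    {x : PathSp n h T} (hx : x ∈ D) (g : Euc n) 
    (hrH : ∀ ε > 0, ∀ᶠ τ in 𝓝[>] t,
      |(∫ ξ in t..τ, H ξ x g) - H t x g * (τ - t)| ≤ ε * (τ - t)) {ε : ℝ} (hε : 0 < ε) :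
    ∀ᶠ τ in 𝓝[>] t, ∀ p ∈ YPair t x c,
      |(∫ ξ in t..τ, H ξ p.1 g) - H t x g * (τ - t)| ≤ ε * (τ - t) := by
  have ht' : t ∈ Set.Icc 0 T := ⟨ht.1, ht.2.le⟩
  have hlt : 0 < lam t + 1 := by linarith [hl0 t]
  set η := ε / 2 / ((lam t + 1) * (1 + ‖g‖)) with hη
  have hηp : 0 < η := by positivity
  have hηe : (lam t + 1) * (1 + ‖g‖) * η = ε / 2 := by
    rw [hη]; field_simp
  have hC : Continuous (fun τ => ∫ ξ in t..τ, c ξ) :=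
    intervalIntegral.continuous_primitive (fun a b => hc.intervalIntegrable) t
  have hCt : Tendsto (fun τ => M * ∫ ξ in t..τ, c ξ) (𝓝[>] t) (𝓝 0) := by
    have := ((hC.tendsto t).const_mul M).mono_left (nhdsWithin_le_nhds (s := Set.Ioi t))
    simpa using this
  have hω : ∃ r > t, ∀ ζ, t ≤ ζ → ζ < r → ‖evalP x ζ - evalP x t‖ ≤ η / 2 := by
    obtain ⟨d, hd, hdd⟩ := Metric.continuous_iff.1 (continuous_evalP x) t (η/2) (half_pos hηp)
    refine ⟨t + d, by linarith, fun ζ h1 h2 => ?_⟩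
    rw [← dist_eq_norm]
    refine (hdd ζ ?_).le
    rw [Real.dist_eq, abs_of_nonneg (by linarith)]
    linarith
  obtain ⟨r, hr, hω⟩ := hω
  filter_upwards [hrl.bd, hrH (ε/2) (half_pos hε), Ioo_mem_nhdsGT ht.2, Ioo_mem_nhdsGT hr,
    hCt.eventually (gt_mem_nhds (half_pos hηp))] with τ e2 e3 hτ hτr hCτ p hp
  have hpos : 0 < τ - t := by linarith [hτ.1]
  obtain ⟨hpK, hpM⟩ := hY t ht' x hx p hp
  have hb := y_bound hc0 hp hpM
  have dist : ∀ ξ, t ≤ ξ → ξ ≤ τ → ‖stopPath ξ p.1 - stopPath ξ x‖ ≤ η := by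
    intro ξ hξ1 hξ2
    rw [← stopPath_sub]
    refine norm_stop_le_of_evalP hh _ (ht.1.trans hξ1) hηp.le fun ζ z1 z2 => ?_
    rw [evalP_sub]
    rcases le_total ζ t with hζ | hζ
    · rw [ac_eval_left hh ht' hp.1 z1 hζ]
      simpa using hηp.le
    · have hζT : ζ ≤ T := z2.trans (hξ2.trans hτ.2.le)
      rw [ac_eval_right hh ht' hp.1 hζ hζT]
      have i1 := int_le_of_ae (n := n) (t := t) (T := T) (a := t) (b := ζ) (q := p.2) (M := M) hc
        (by filter_upwards [hb] with ξ hξ _ using hξ) le_rfl hζ hζT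
      have i2 := mul_le_mul_of_nonneg_left (int_mono hc hc0 (le_refl t) hζ (z2.trans hξ2)) hM.le
      have i3 := hω ζ hζ (z2.trans_lt (hξ2.trans_lt hτr.2))
      have i4 : evalP x t + (∫ ξ in t..ζ, p.2 ξ) - evalP x ζ =
          (∫ ξ in t..ζ, p.2 ξ) - (evalP x ζ - evalP x t) := by abel
      rw [i4]
      refine (norm_sub_le _ _).trans ?_
      linarith
  have key := int_diff_le (hHi p.1 g) (hHi x g) ht.1 hτ.1.le hτ.2.le
    (B := fun ξ => lam ξ * ((1 + ‖g‖) * η)) (hl.mul_const _) (by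
      filter_upwards [h3 p.1 hpK x (hDK hx) g] with ξ k3 k1 k2
      refine k3.trans ?_
      have := dist ξ k1 k2
      have := hl0 ξ
      gcongr)
  rw [intervalIntegral.integral_mul_const] at key
  have b1 := mul_le_mul_of_nonneg_right e2 (show 0 ≤ (1 + ‖g‖) * η by positivity)
  have b2 : (lam t + 1) * (τ - t) * ((1 + ‖g‖) * η) = ε / 2 * (τ - t) := by
    rw [← hηe]; ring
  have b5 := abs_sub_le (∫ ξ in t..τ, H ξ p.1 g) (∫ ξ in t..τ, H ξ x g) (H t x g * (τ - t))
  linarith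

lemma ypair_ind {n : ℕ} {h T : ℝ} {t : ℝ} (ht : 0 ≤ t) {x : PathSp n h T} {cH : ℝ → ℝ}
    {p : PathSp n h T × (ℝ → Euc n)} (hp : p ∈ YPair t x cH) :
    p ∈ YPair t x ((Set.Icc 0 T).indicator cH) := by
  refine ⟨hp.1, ?_⟩
  filter_upwards [hp.2, ae_restrict_mem measurableSet_Icc] with ξ hξ hm
  rwa [indicator_of_mem (show ξ ∈ Set.Icc 0 T from ⟨ht.trans hm.1, hm.2⟩)]

lemma split_int {n : ℕ} {h T : ℝ} (hh : 0 ≤ h) {H : ℝ → PathSp n h T → Euc n → ℝ}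
    (hHi : ∀ x s, IntegrableOn (fun t => H t x s) (Set.Icc 0 T)) {t : ℝ}
    (ht : t ∈ Set.Icc 0 T) {x : PathSp n h T} {p : PathSp n h T × (ℝ → Euc n)}
    (hp : p ∈ ACPair t x) (g : Euc n) {τ : ℝ} (h1 : t ≤ τ) (h2 : τ ≤ T) :
    ∫ ξ in t..τ, (@inner ℝ _ _ g (p.2 ξ) - H ξ p.1 g) =
      @inner ℝ _ _ g (evalP p.1 τ - evalP x t) - ∫ ξ in t..τ, H ξ p.1 g := by
  have hi := ac_ii hp le_rfl h1 h2
  have hi2 : IntervalIntegrable (fun ξ => H ξ p.1 g) volume t τ :=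
    (intervalIntegrable_iff_integrableOn_Icc_of_le h1).2
      ((hHi p.1 g).mono_set (Icc_subset_Icc ht.1 h2))
  have hi3 : IntervalIntegrable (fun ξ => @inner ℝ _ _ g (p.2 ξ)) volume t τ :=
    ⟨(innerSL ℝ g).integrable_comp hi.1, (innerSL ℝ g).integrable_comp hi.2⟩
  rw [intervalIntegral.integral_sub hi3 hi2]
  congr 1
  rw [ac_eval_right hh ht hp h1 h2, add_sub_cancel_left]
  exact (innerSL ℝ g).intervalIntegral_comp_comm hi

lemma usc_slice {n : ℕ} {h T : ℝ} {φ : ℝ → PathSp n h T → ℝ}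
    (hu : UpperSemicontinuousOn (fun p : ℝ × PathSp n h T => φ p.1 p.2)
      (Set.Icc 0 T ×ˢ (Set.univ : Set (PathSp n h T)))) {τ : ℝ} (hτ : τ ∈ Set.Icc 0 T) :
    UpperSemicontinuous (φ τ) := by
  intro z y hy
  have h1 := hu (τ, z) ⟨hτ, mem_univ _⟩ y hy
  have h2 : Tendsto (fun w : PathSp n h T => (τ, w)) (𝓝 z)
      (𝓝[Set.Icc 0 T ×ˢ (Set.univ : Set (PathSp n h T))] (τ, z)) :=
    tendsto_nhdsWithin_iff.2 ⟨(by fun_prop : Continuous fun w : PathSp n h T => (τ, w)).tendsto z,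
      Eventually.of_forall fun w => ⟨hτ, mem_univ _⟩⟩
  exact h2.eventually h1

lemma hasCiDeriv_neg {n : ℕ} {h T : ℝ} {φ : ℝ → PathSp n h T → ℝ} {t : ℝ} {x : PathSp n h T}
    {a : ℝ} {g : Euc n} (hd : HasCiDeriv φ t x a g) :
    HasCiDeriv (fun τ z => - φ τ z) t x (-a) (-g) := by
  intro p hp
  obtain ⟨o, h1, h2⟩ := hd p hp
  refine ⟨fun r => - o r, fun τ hτ => ?_, ?_⟩
  · have := h1 τ hτ
    rw [inner_neg_left]
    linarith
  · have := h2.neg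
    simp only [neg_zero] at this
    refine this.congr fun τ => ?_
    rw [neg_div]

/-- Theorem on consistency on a countable union of compacts:
there is a full-measure set `E ⊆ [0,T)` such that a minimax solution satisfies
the Hamilton–Jacobi equation at every point of `E × S` where it is
ci-differentiable. -/
theorem stmt8 {n : ℕ} {h T : ℝ} (hT : 0 < T) (hh : 0 ≤ h)
    (H : ℝ → PathSp n h T → Euc n → ℝ) (cH : ℝ → ℝ) (hH : CondA H cH)
    (σ : PathSp n h T → ℝ) (hσ : Continuous σ)
    (D : ℕ → Set (PathSp n h T)) (hD : ∀ k, IsCompact (D k)) :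
    ∃ E : Set ℝ, E ⊆ Set.Ico 0 T ∧ volume E = ENNReal.ofReal T ∧
      ∀ φ : ℝ → PathSp n h T → ℝ, MinimaxSol H cH σ φ →
        ∀ t ∈ E, ∀ x ∈ ⋃ k, D k, ∀ (a : ℝ) (g : Euc n),
          HasCiDeriv φ t x a g → a + H t x g = 0 := by
  have hHi := H_integ hH
  obtain ⟨h1, ⟨E2, hE2, hE2v, hE2c⟩, h3, h4, h5⟩ := hH
  set c := (Set.Icc 0 T).indicator cH with hcdef
  obtain ⟨hc, hc0⟩ := ind_integ h4.1
  have hcomp := fun k => compact_Y hh hc hc0 (hD k)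
  choose K M hK hM hDK hY using hcomp
  have ha3 := fun k => a3_ae h1 h3 (hK k)
  choose lam hl hl0 hl3 using ha3
  have ha4 := a4_ae h1 h4
  have hsep := fun k => (hD k).isSeparable.exists_countable_dense_subset
  choose Q hQD hQc hQ using hsep
  obtain ⟨Q', hQ'c, hQ'⟩ := TopologicalSpace.exists_countable_dense (Euc n)
  -- the almost everywhere conditions
  have hG : ∀ᵐ t, t ∈ Set.Icc 0 T → t ≠ T ∧ RightLeb c t ∧ (∀ k, RightLeb (lam k) t) ∧
      ∀ k, ∀ x ∈ Q k, ∀ s ∈ Q', RightLeb (fun ξ => H ξ x s) t := by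
    have g0 : ∀ᵐ t : ℝ, t ≠ T := by simp [ae_iff, measure_singleton]
    have g1 := ae_rightLeb hT (hc.integrableOn (s := Set.Icc 0 T))
    have g2 : ∀ᵐ t : ℝ, ∀ k, t ∈ Set.Icc 0 T → RightLeb (lam k) t :=
      ae_all_iff.2 fun k => ae_rightLeb hT ((hl k).integrableOn)
    have g3 : ∀ᵐ t : ℝ, ∀ k, ∀ x ∈ Q k, ∀ s ∈ Q', t ∈ Set.Icc 0 T →
        RightLeb (fun ξ => H ξ x s) t :=
      ae_all_iff.2 fun k => (ae_ball_iff (hQc k)).2 fun x _ => (ae_ball_iff hQ'c).2 fun s _ =>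
        ae_rightLeb hT (hHi x s)
    filter_upwards [g0, g1, g2, g3] with t g0 g1 g2 g3 hm
    exact ⟨g0, g1 hm, fun k => g2 k hm, fun k x hx s hs => g3 k x hx s hs hm⟩
  set G : Set ℝ := {t | t ∈ Set.Icc 0 T → t ≠ T ∧ RightLeb c t ∧ (∀ k, RightLeb (lam k) t) ∧
      ∀ k, ∀ x ∈ Q k, ∀ s ∈ Q', RightLeb (fun ξ => H ξ x s) t} with hGdef
  have hGae : G ∈ ae volume := hG
  refine ⟨E2 ∩ G, ?_, ?_, ?_⟩
  · intro t ht
    exact ⟨(hE2 ht.1).1, lt_of_le_of_ne (hE2 ht.1).2 (ht.2 (hE2 ht.1)).1⟩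
  · rw [← hE2v]
    exact measure_congr (inter_ae_eq_left_of_ae_eq_univ (eventuallyEq_univ.2 hGae))
  intro φ hφ t ht x hx a g hd
  obtain ⟨k, hxk⟩ := mem_iUnion.1 hx
  have htI := hE2 ht.1
  obtain ⟨htT, hrc, hrl, hrH⟩ := ht.2 htI
  have ht' : t ∈ Set.Ico 0 T := ⟨htI.1, lt_of_le_of_ne htI.2 htT⟩
  have hest : ∀ ε > 0, ∀ᶠ τ in 𝓝[>] t, ∀ p ∈ YPair t x c,
      |(∫ ξ in t..τ, H ξ p.1 g) - H t x g * (τ - t)| ≤ ε * (τ - t) := fun ε hε =>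
    est_H hh hHi hc hc0 (hl k) (hl0 k) (hDK k) (hM k) (hY k) (hl3 k) ht' hrc (hrl k) hxk g
      (fun ε hε => rightLeb_H hHi hc hc0 (hl k) (hl0 k) (hDK k) (hl3 k) ha4 (hQD k) (hQ k) hQ' ht'
        (hE2c t ht.1) hrc (hrl k) (hrH k) hxk g hε) hε
  obtain ⟨⟨hna, hlsc, -, hU⟩, ⟨-, husc, -, hL⟩⟩ := hφ
  have hB : 0 ≤ c t + 1 := by linarith [hc0 t]
  have le1 : a ≤ - H t x g := by
    refine le_of_forall_pos_le_add fun ε hε => ?_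
    refine core hh ht' hc hc0 (hM k) hB hrc.bd hna (fun τ hτ => usc_slice husc hτ) hd ?_
    filter_upwards [hest ε hε, Ioo_mem_nhdsGT ht'.2] with τ e1 hτ
    obtain ⟨p, hp, hpφ⟩ := hU t ht' x g τ ⟨hτ.1, hτ.2.le⟩
    have hp' := ypair_ind htI.1 hp
    refine ⟨p, hp.1, y_bound hc0 hp' (hY k t htI x hxk p hp').2, ?_⟩
    rw [split_int hh hHi htI hp.1 g hτ.1.le hτ.2.le] at hpφ
    have := (abs_le.1 (e1 p hp')).1
    linarith
  have le2 : - a ≤ H t x g := by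
    refine le_of_forall_pos_le_add fun ε hε => ?_
    refine core (φ := fun τ z => - φ τ z) hh ht' hc hc0 (hM k) hB hrc.bd ?_ ?_
      (hasCiDeriv_neg hd) ?_
    · intro τ hτ z
      exact congrArg Neg.neg (hna τ hτ z)
    · intro τ hτ
      refine usc_slice (φ := fun τ z => - φ τ z) ?_ hτ
      intro q hq y hy
      have := hlsc q hq (-y) (by have hy' : -φ q.1 q.2 < y := hy; change -y < φ q.1 q.2; linarith)
      filter_upwards [this] with w hw
      have hw' : -y < φ w.1 w.2 := hw
      change -φ w.1 w.2 < y
      linarith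
    filter_upwards [hest ε hε, Ioo_mem_nhdsGT ht'.2] with τ e1 hτ
    obtain ⟨p, hp, hpφ⟩ := hL t ht' x g τ ⟨hτ.1, hτ.2.le⟩
    have hp' := ypair_ind htI.1 hp
    refine ⟨p, hp.1, y_bound hc0 hp' (hY k t htI x hxk p hp').2, ?_⟩
    rw [split_int hh hHi htI hp.1 g hτ.1.le hτ.2.le] at hpφ
    have := (abs_le.1 (e1 p hp')).2
    rw [inner_neg_left]
    linarith
  linarith

end
end
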